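/- arXiv:1009.0414 — 2 statements merged into one kernel-verified Lean document; each statement's English description precedes it below -/
import Mathlib

section
/- The invariant algebra S(V)^{K_I} is a polynomial algebra on the n generators θ_1, q_{1,1}, …, q_{1,n_1−1}, θ_2, q_{2,1}, …, q_{2,n_2−1}, …, θ_ℓ, q_{ℓ,1}, …, q_{ℓ,n_ℓ−1}; that is, these n polynomials are algebraically independent over F_q and S(V)^{K_I} = F_q[θ_1, q_{1,1}, …, q_{1,n_1−1}, …, θ_ℓ, q_{ℓ,1}, …, q_{ℓ,n_ℓ−1}]. -/
open scoped TensorProduct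
open MvPolynomial Finset

noncomputable section

/-- The symmetric algebra `S(V) = F[x_1,…,x_n]` of the natural module `V = F^n`. -/
abbrev SV (F : Type) [Field F] (n : ℕ) := MvPolynomial (Fin n) F

/-- The exterior algebra `Λ(V) = E[y_1,…,y_n]`. -/
abbrev LV (F : Type) [Field F] (n : ℕ) := ExteriorAlgebra F (Fin n → F)

/-- `S(V) ⊗ Λ(V)`. -/
abbrev SL (F : Type) [Field F] (n : ℕ) := SV F n ⊗[F] LV F n

/-- the variable `x_{a+1}` (0-indexed `a`), junk value `0` out of range. -/
def xV (F : Type) [Field F] (n a : ℕ) : SV F n :=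
  if h : a < n then X ⟨a, h⟩ else 0

/-- the exterior generator `y_{a+1}` (0-indexed `a`). -/
def yV (F : Type) [Field F] (n a : ℕ) : LV F n :=
  if h : a < n then ExteriorAlgebra.ι F (Pi.single (⟨a, h⟩ : Fin n) (1 : F)) else 0

/-- the product `y_{s_1} ⋯ y_{s_j}` over `S = {s_1 < ⋯ < s_j}` in increasing order. -/
def yProd (F : Type) [Field F] (n : ℕ) (S : Finset ℕ) : LV F n :=
  ((S.sort (· ≤ ·)).map (yV F n)).prod

/-- determinant of the matrix `(x_t^{q^c})` with rows indexed by `c ∈ R` in increasing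
order and columns by `t ∈ C` in increasing order; junk value `0` if sizes differ. -/
def subDet (F : Type) [Field F] (q n : ℕ) (R C : Finset ℕ) : SV F n :=
  if h : C.card = R.card then
    Matrix.det (Matrix.of fun i j : Fin R.card =>
      xV F n (C.orderEmbOfFin h j) ^ q ^ (R.orderEmbOfFin rfl i : ℕ))
  else 0

/-- Mui's element `M_{m;b_1,…,b_j}` where `B = {b_1 < ⋯ < b_j}` (0-indexed `b`'s);
for `B = ∅` this is the Moore determinant `det (x_t^{q^c})`. -/
def MuiM (F : Type) [Field F] (q n m : ℕ) (B : Finset ℕ) : SL F n :=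
  ∑ S ∈ (range m).powersetCard B.card,
    ((-1 : F) ^ (B.card * (B.card + 1) / 2 + (∑ s ∈ S, s) + B.card)) •
      (subDet F q n (range m \ B) (range m \ S) ⊗ₜ[F] yProd F n S)

/-- `∏_{c : F^a} (c_1 x_1 + ⋯ + c_a x_a + x_{t+1})` (0-indexed `t`). -/
def linProd (F : Type) [Field F] [Fintype F] (n a t : ℕ) : SV F n :=
  ∏ c : Fin a → F, ((∑ k : Fin a, MvPolynomial.C (c k) * xV F n k) + xV F n t)

/-- Dickson's `L_m = V_1 V_2 ⋯ V_m`. -/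
def Lm (F : Type) [Field F] [Fintype F] (n m : ℕ) : SV F n :=
  ∏ a ∈ range m, linProd F n a a

/-- The property characterizing the Dickson invariants `Q_{m,k}`:
`Q_{m,k} · L_m = L_{m,k}` in `F[x_1,…,x_m]`. -/
def DicksonProp (F : Type) [Field F] [Fintype F] (q : ℕ)
    (Q : (m : ℕ) → ℕ → SV F m) : Prop :=
  ∀ m k : ℕ, k ≤ m →
    Q m k * Lm F m m = subDet F q m (range (m + 1) \ {k}) (range m)

/-- action of a matrix on `S(V)` by linear substitution: `x_j ↦ ∑_i g_{ij} x_i`. -/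
def gAct (F : Type) [Field F] (n : ℕ) (g : Matrix (Fin n) (Fin n) F) :
    SV F n →ₐ[F] SV F n :=
  MvPolynomial.aeval fun j => ∑ i, MvPolynomial.C (g i j) * MvPolynomial.X i

/-- action of a matrix on `Λ(V)` by linear substitution: `y_j ↦ ∑_i g_{ij} y_i`. -/
def eAct (F : Type) [Field F] (n : ℕ) (g : Matrix (Fin n) (Fin n) F) :
    LV F n →ₐ[F] LV F n :=
  ExteriorAlgebra.map g.mulVecLin

/-- diagonal action of a matrix on `S(V) ⊗ Λ(V)`. -/
def tAct (F : Type) [Field F] (n : ℕ) (g : Matrix (Fin n) (Fin n) F) :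
    SL F n →ₐ[F] SL F n :=
  Algebra.TensorProduct.map (gAct F n g) (eAct F n g)

/-- the invariants of a set of matrices on `S(V) ⊗ Λ(V)`, as an `F`-subspace. -/
def invSL (F : Type) [Field F] (n : ℕ) (P : Set (Matrix (Fin n) (Fin n) F)) :
    Submodule F (SL F n) where
  carrier := {f | ∀ g ∈ P, tAct F n g f = f}
  add_mem' := fun ha hb g hg => by rw [map_add, ha g hg, hb g hg]
  zero_mem' := fun g hg => map_zero _
  smul_mem' := fun c f hf g hg => by rw [map_smul, hf g hg]

/-- the invariants of `S(V) ⊗ Λ(V) ⊗ Det^k`, i.e. elements with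
`det(g)^k (g·f) = f` for all `g ∈ P`. -/
def invSLtw (F : Type) [Field F] (n k : ℕ) (P : Set (Matrix (Fin n) (Fin n) F)) :
    Submodule F (SL F n) where
  carrier := {f | ∀ g ∈ P, g.det ^ k • tAct F n g f = f}
  add_mem' := fun ha hb g hg => by rw [map_add, smul_add, ha g hg, hb g hg]
  zero_mem' := fun g hg => by rw [map_zero, smul_zero]
  smul_mem' := fun c f hf g hg => by rw [map_smul, smul_comm, hf g hg]

/-- the invariants of a set of matrices on `S(V)`, as an `F`-subalgebra. -/
def invS (F : Type) [Field F] (n : ℕ) (P : Set (Matrix (Fin n) (Fin n) F)) :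
    Subalgebra F (SV F n) where
  carrier := {f | ∀ g ∈ P, gAct F n g f = f}
  mul_mem' := fun ha hb g hg => by rw [map_mul, ha g hg, hb g hg]
  one_mem' := fun g hg => map_one _
  add_mem' := fun ha hb g hg => by rw [map_add, ha g hg, hb g hg]
  zero_mem' := fun g hg => map_zero _
  algebraMap_mem' := fun c g hg => (gAct F n g).commutes c

/-- `v_{i,j+1}` (0-indexed `j`) for the composition `I`. -/
def vij (F : Type) [Field F] [Fintype F] (n : ℕ) (I : Composition n)
    (i : Fin I.length) (j : ℕ) : SV F n :=
  linProd F n (I.sizeUpTo i) (I.sizeUpTo i + j)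

/-- `θ_i = L_{n_i}(v_{i,1},…,v_{i,n_i})`. -/
def theta (F : Type) [Field F] [Fintype F] (n : ℕ) (I : Composition n)
    (i : Fin I.length) : SV F n :=
  MvPolynomial.aeval (fun t : Fin (I.blocksFun i) => vij F n I i t)
    (Lm F (I.blocksFun i) (I.blocksFun i))

/-- `q_{i,k} = Q_{n_i,k}(v_{i,1},…,v_{i,n_i})`, given the Dickson polynomials `Q`. -/
def qInv (F : Type) [Field F] [Fintype F] (n : ℕ) (Q : (m : ℕ) → ℕ → SV F m)
    (I : Composition n) (i : Fin I.length) (k : ℕ) : SV F n :=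
  MvPolynomial.aeval (fun t : Fin (I.blocksFun i) => vij F n I i t)
    (Q (I.blocksFun i) k)

/-- the index of the block (0-indexed) of the composition `I` containing `a`. -/
def blkIdx (n : ℕ) (I : Composition n) (a : ℕ) : ℕ :=
  ((range I.length).filter fun i => I.sizeUpTo (i + 1) ≤ a).card

/-- the parabolic subgroup `P_I`: invertible block upper-triangular matrices. -/
def PIset (F : Type) [Field F] (n : ℕ) (I : Composition n) :
    Set (Matrix (Fin n) (Fin n) F) :=
  {g | IsUnit g.det ∧ ∀ a b : Fin n, blkIdx n I b < blkIdx n I a → g a b = 0}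

/-- the subgroup `K_I ≤ P_I`: block upper-triangular with all diagonal blocks
of determinant `1`. -/
def KIset (F : Type) [Field F] (n : ℕ) (I : Composition n) :
    Set (Matrix (Fin n) (Fin n) F) :=
  {g | IsUnit g.det ∧ (∀ a b : Fin n, blkIdx n I b < blkIdx n I a → g a b = 0) ∧
    ∀ i : Fin I.length,
      Matrix.det (Matrix.of fun a b : Fin (I.blocksFun i) =>
        g (I.embedding i a) (I.embedding i b)) = 1}

/-- the unipotent subgroup `U_n` of uni-uppertriangular matrices. -/
def Uset (F : Type) [Field F] (n : ℕ) : Set (Matrix (Fin n) (Fin n) F) :=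
  {g | (∀ a b : Fin n, b < a → g a b = 0) ∧ ∀ a : Fin n, g a a = 1}

/-- `SL_n(q)`. -/
def SLset (F : Type) [Field F] (n : ℕ) : Set (Matrix (Fin n) (Fin n) F) :=
  {g | g.det = 1}

/-- `GL_n(q)`. -/
def GLset (F : Type) [Field F] (n : ℕ) : Set (Matrix (Fin n) (Fin n) F) :=
  {g | IsUnit g.det}

/-- the bigraded piece `S^i(V) ⊗ Λ^j(V)` of `S(V) ⊗ Λ(V)`. -/
def piece (F : Type) [Field F] (n i j : ℕ) : Submodule F (SL F n) :=
  LinearMap.range (TensorProduct.map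
    (MvPolynomial.homogeneousSubmodule (Fin n) F i).subtype
    (LinearMap.range (ExteriorAlgebra.ι F (M := Fin n → F)) ^ j).subtype)

/-- the Hilbert series in `ℤ[s][[t]]` of a bigraded subspace `W` of `S(V) ⊗ Λ(V)`:
the coefficient of `t^i` is `∑_{j=0}^n dim (W ∩ (S^i ⊗ Λ^j)) s^j`. -/
def Hser (F : Type) [Field F] (n : ℕ) (W : Submodule F (SL F n)) :
    PowerSeries (Polynomial ℤ) :=
  PowerSeries.mk fun i => ∑ j ∈ range (n + 1),
    Polynomial.C (Module.finrank F ↥(W ⊓ piece F n i j) : ℤ) * Polynomial.X ^ j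

/-- the Hilbert series in `ℤ[[t]]` of a graded subalgebra of `S(V)`. -/
def HserS (F : Type) [Field F] (n : ℕ) (W : Subalgebra F (SV F n)) :
    PowerSeries ℤ :=
  PowerSeries.mk fun d =>
    (Module.finrank F ↥(Subalgebra.toSubmodule W ⊓ MvPolynomial.homogeneousSubmodule (Fin n) F d) : ℤ)

/-- the index set for Mui-type basis elements attached to the composition `I`:
pairs `(i, B)` with `B = {b_1 < ⋯ < b_j} ⊆ {0,…,m_{i+1}−1}` nonempty and
`max B ≥ m_i` (0-indexed `i`). -/
def Adm (n : ℕ) (I : Composition n) : Finset (Fin I.length × Finset ℕ) :=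
  (Finset.univ ×ˢ (range n).powerset).filter fun x =>
    x.2 ⊆ range (I.sizeUpTo ((x.1 : ℕ) + 1)) ∧ x.2.Nonempty ∧ ∃ b ∈ x.2, I.sizeUpTo (x.1 : ℕ) ≤ b

section KIInvariants

variable {F : Type} [Field F] [Fintype F] {A B : Type*} [CommRing A] [Algebra F A]
  [CommRing B] [Algebra F B]

/-- The product of `∑ k, c k • u k + y` over all `c : F^m`. -/
def affProd (F : Type) [Field F] [Fintype F] {A : Type*} [CommRing A] [Algebra F A]
    (u : ℕ → A) (m : ℕ) (y : A) : A :=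
  ∏ c : Fin m → F, ((∑ k : Fin m, c k • u k) + y)

/-- The determinant of `(u_j ^ q ^ (e i))`, where `q = |F|`. -/
def mooreMinor (F : Type) [Fintype F] {A : Type*} [CommRing A] {m : ℕ} (e : Fin m → ℕ)
    (u : ℕ → A) : A :=
  Matrix.det (Matrix.of fun i j : Fin m => u j ^ Fintype.card F ^ e i)

/-- The Moore determinant of `u_0, …, u_{m-1}`. -/
abbrev moore (F : Type) [Fintype F] {A : Type*} [CommRing A] (m : ℕ) (u : ℕ → A) : A :=
  mooreMinor F (fun i : Fin m => (i : ℕ)) u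

lemma frobenius_pow_apply (k : ℕ) (a : A) :
    (FiniteField.frobeniusAlgHom F A ^ k) a = a ^ Fintype.card F ^ k := by
  simp [AlgHom.coe_pow, FiniteField.coe_frobeniusAlgHom, pow_iterate]

lemma map_affProd (φ : A →ₐ[F] B) (u : ℕ → A) (m : ℕ) (y : A) :
    φ (affProd F u m y) = affProd F (φ ∘ u) m (φ y) := by
  simp [affProd, map_prod]

lemma map_mooreMinor (φ : A →ₐ[F] B) {m : ℕ} (e : Fin m → ℕ) (u : ℕ → A) :
    φ (mooreMinor F e u) = mooreMinor F e (φ ∘ u) := by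
  simp only [mooreMinor, AlgHom.map_det]
  congr 1
  ext i j
  simp

lemma affProd_congr {u v : ℕ → A} {m : ℕ} (h : ∀ k < m, u k = v k) (y : A) :
    affProd F u m y = affProd F v m y := by
  refine Finset.prod_congr rfl fun c _ => ?_
  congr 1
  exact Finset.sum_congr rfl fun k _ => by rw [h k k.2]

omit [Field F] [Algebra F A] in
lemma mooreMinor_congr {u v : ℕ → A} {m : ℕ} {e : Fin m → ℕ} (h : ∀ k < m, u k = v k) :
    mooreMinor F e u = mooreMinor F e v := by
  simp only [mooreMinor]
  congr 1
  ext i j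
  simp [h j j.2]

lemma mooreMinor_transform {m : ℕ} (e : Fin m → ℕ) (g : Matrix (Fin m) (Fin m) F)
    {u v : ℕ → A} (h : ∀ j : Fin m, v j = ∑ i, g i j • u i) :
    mooreMinor F e v = g.det • mooreMinor F e u := by
  have : (Matrix.of fun i j : Fin m => v j ^ Fintype.card F ^ e i) =
      (Matrix.of fun i j : Fin m => u j ^ Fintype.card F ^ e i) *
        (algebraMap F A).mapMatrix g := by
    ext i j
    simp only [Matrix.of_apply, Matrix.mul_apply, h, ← frobenius_pow_apply (F := F), map_sum, map_smul,
      RingHom.mapMatrix_apply, Matrix.map_apply]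
    exact Finset.sum_congr rfl fun k _ => by rw [Algebra.smul_def, mul_comm]
  rw [mooreMinor, this, Matrix.det_mul, ← RingHom.map_det, Algebra.smul_def, mul_comm]
  rfl

omit [Field F] [Algebra F A] in
/-- The Laplace expansion of the Moore determinant of `u_0, …, u_{m-1}, y`. -/
lemma moore_succ_laplace (m : ℕ) (u : ℕ → A) :
    moore F (m + 1) u = ∑ k : Fin (m + 1), (-1) ^ (k + m : ℕ) *
      mooreMinor F (fun i => (k.succAbove i : ℕ)) u * u m ^ Fintype.card F ^ (k : ℕ) := by
  rw [moore, mooreMinor, Matrix.det_succ_column _ (Fin.last m)]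
  refine Finset.sum_congr rfl fun k _ => ?_
  simp only [Matrix.of_apply, Fin.val_last, mooreMinor]
  rw [mul_right_comm]
  congr 3
  ext i j
  simp

lemma laplace_eq_zero (m : ℕ) (u : ℕ → A) (c : Fin m → F) :
    ∑ k : Fin (m + 1), (-1) ^ (k + m : ℕ) *
      mooreMinor F (fun i => (k.succAbove i : ℕ)) u *
        (∑ j, c j • u j) ^ Fintype.card F ^ (k : ℕ) = 0 := by
  have h : ∀ j : Fin m, ∑ k : Fin (m + 1), (-1) ^ (k + m : ℕ) *
      mooreMinor F (fun i => (k.succAbove i : ℕ)) u * u j ^ Fintype.card F ^ (k : ℕ) = 0 := by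
    intro j
    have h1 := moore_succ_laplace (F := F) m (Function.update u m (u j))
    rw [moore, mooreMinor, Matrix.det_zero_of_column_eq (i := j.castSucc) (j := Fin.last m)
      (Fin.castSucc_lt_last j).ne] at h1
    · rw [h1]
      refine Finset.sum_congr rfl fun k _ => ?_
      rw [Function.update_self]
      congr 2
      exact mooreMinor_congr fun i hi => (Function.update_of_ne hi.ne _ _).symm
    · intro i
      simp [Function.update_of_ne j.2.ne]
  simp only [← frobenius_pow_apply (F := F), map_sum, map_smul] at h ⊢
  simp only [Finset.mul_sum, mul_smul_comm]
  rw [Finset.sum_comm]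
  simp only [← Finset.smul_sum, h, smul_zero, Finset.sum_const_zero]

open Polynomial in
lemma moore_mul_affProd_of_linearIndependent [IsDomain A] (m : ℕ) (u : ℕ → A)
    (hu : LinearIndependent F fun k : Fin m => u k) (y : A) :
    moore F m u * affProd F u m y = ∑ k : Fin (m + 1), (-1) ^ (k + m : ℕ) *
      mooreMinor F (fun i => (k.succAbove i : ℕ)) u * y ^ Fintype.card F ^ (k : ℕ) := by
  classical
  set P : A[X] := ∏ c : Fin m → F, (Polynomial.X - Polynomial.C (-∑ k : Fin m, c k • u k)) with hP
  set R : A[X] := ∑ k : Fin (m + 1), Polynomial.C ((-1) ^ (k + m : ℕ) *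
      mooreMinor F (fun i => (k.succAbove i : ℕ)) u) * Polynomial.X ^ Fintype.card F ^ (k : ℕ) with hR
  have hPm : P.Monic := monic_prod_of_monic _ _ fun c _ => monic_X_sub_C _
  have hPd : P.natDegree = Fintype.card F ^ m := by
    rw [hP, natDegree_prod_of_monic _ _ fun c _ => monic_X_sub_C _]
    simp only [natDegree_X_sub_C, Finset.sum_const, Finset.card_univ, Fintype.card_pi,
      Finset.prod_const, Fintype.card_fin, smul_eq_mul, mul_one]
  have hinj : Function.Injective fun c : Fin m → F => -∑ k : Fin m, c k • u k := by
    intro c d h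
    have h' := neg_injective h
    simp only [← Fintype.linearCombination_apply (R := F)] at h'
    exact linearIndependent_iff_injective_fintypeLinearCombination.1 hu h'
  have hq : 1 < Fintype.card F := Fintype.one_lt_card
  have key : Polynomial.C (moore F m u) * P = R := by
    refine Polynomial.eq_of_degree_sub_lt_of_eval_finset_eq
      (Finset.univ.image fun c : Fin m → F => -∑ k : Fin m, c k • u k) ?_ ?_
    · rw [Finset.card_image_of_injective _ hinj]
      have h1 : Polynomial.C (moore F m u) * P - R = Polynomial.C (moore F m u) *
          (P - Polynomial.X ^ Fintype.card F ^ m) - ∑ k : Fin m, Polynomial.C ((-1) ^ (k + m : ℕ) *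
            mooreMinor F (fun i => (k.castSucc.succAbove i : ℕ)) u) *
              Polynomial.X ^ Fintype.card F ^ (k : ℕ) := by
        rw [hR, Fin.sum_univ_castSucc]
        simp [moore, ← two_mul]
        ring
      have hc : #(Finset.univ : Finset (Fin m → F)) = Fintype.card F ^ m := by simp
      rw [h1, hc]
      refine (degree_sub_le _ _).trans_lt (max_lt ?_ ?_)
      · rw [← Polynomial.smul_eq_C_mul]
        refine (degree_smul_le _ _).trans_lt ?_
        have := degree_sub_lt_left (p := P) (q := Polynomial.X ^ Fintype.card F ^ m)
          (by rw [degree_eq_natDegree hPm.ne_zero, hPd, degree_X_pow]) hPm.ne_zero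
          (by rw [hPm.leadingCoeff, leadingCoeff_X_pow])
        rwa [degree_eq_natDegree hPm.ne_zero, hPd] at this
      · refine (degree_sum_le _ _).trans_lt ((Finset.sup_lt_iff (WithBot.bot_lt_coe _)).2 fun k _ => ?_)
        refine (degree_C_mul_X_pow_le _ _).trans_lt ?_
        exact_mod_cast Nat.pow_lt_pow_right hq k.2
    · intro x hx
      obtain ⟨c, -, rfl⟩ := Finset.mem_image.1 hx
      have h2 := laplace_eq_zero (F := F) m u (-c)
      have h3 : -∑ k : Fin m, c k • u k = ∑ j, (-c) j • u j := by simp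
      rw [h3, hR, eval_finsetSum]
      simp only [Polynomial.eval_mul, Polynomial.eval_C, Polynomial.eval_pow, Polynomial.eval_X]
      rw [h2, ← h3, hP, Polynomial.eval_prod, Finset.prod_eq_zero (Finset.mem_univ c), mul_zero]
      rw [Polynomial.eval_sub, Polynomial.eval_X, Polynomial.eval_C, sub_self]
  have h4 := congrArg (Polynomial.eval y) key
  rw [hR, eval_finsetSum, hP] at h4
  simp only [Polynomial.eval_mul, Polynomial.eval_C, Polynomial.eval_pow, Polynomial.eval_X,
    Polynomial.eval_prod, Polynomial.eval_sub] at h4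
  rw [← h4, affProd]
  congr 2
  ext c
  ring

omit [Fintype F] in
lemma linearIndependent_X_nat (m : ℕ) :
    LinearIndependent F fun k : Fin m => (X (k : ℕ) : MvPolynomial ℕ F) :=
  (MvPolynomial.linearIndependent_X ℕ F).comp _ Fin.val_injective

lemma moore_mul_affProd (m : ℕ) (u : ℕ → A) (y : A) :
    moore F m u * affProd F u m y = ∑ k : Fin (m + 1), (-1) ^ (k + m : ℕ) *
      mooreMinor F (fun i => (k.succAbove i : ℕ)) u * y ^ Fintype.card F ^ (k : ℕ) := by
  have h := congrArg (MvPolynomial.aeval (Function.update u m y))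
    (moore_mul_affProd_of_linearIndependent m _ (linearIndependent_X_nat (F := F) m) (X m))
  have hu : ∀ i < m, ((MvPolynomial.aeval (R := F) (Function.update u m y)) ∘ X) i = u i := by
    intro i hi
    simp [hi.ne]
  simpa [map_affProd, map_mooreMinor, affProd_congr hu, mooreMinor_congr hu] using h

lemma moore_succ (m : ℕ) (u : ℕ → A) :
    moore F (m + 1) u = moore F m u * affProd F u m (u m) := by
  rw [moore_succ_laplace, moore_mul_affProd]

lemma moore_eq_prod (m : ℕ) (u : ℕ → A) :
    moore F m u = ∏ a ∈ range m, affProd F u a (u a) := by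
  induction m with
  | zero => simp [moore, mooreMinor]
  | succ m ih => rw [moore_succ, ih, Finset.prod_range_succ]

lemma moore_ne_zero [IsDomain A] {m : ℕ} {u : ℕ → A}
    (hu : LinearIndependent F fun k : Fin m => u k) : moore F m u ≠ 0 := by
  rw [moore_eq_prod, Finset.prod_ne_zero_iff]
  intro a ha
  rw [Finset.mem_range] at ha
  refine Finset.prod_ne_zero_iff.2 fun c _ h => ?_
  have h1 := linearIndependent_iff'.1 (hu.comp (Fin.castLE (Nat.succ_le_of_lt ha))
    (Fin.castLE_injective _)) Finset.univ (Fin.snoc c 1) (by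
      rw [Fin.sum_univ_castSucc]
      simpa using h) (Fin.last a) (Finset.mem_univ _)
  simp at h1

omit [Fintype F] in
lemma subDet_eq_det (q n : ℕ) {N : ℕ} {R C : Finset ℕ} (hR : R.card = N) (hC : C.card = N) :
    subDet F q n R C = Matrix.det (Matrix.of fun i j : Fin N =>
      xV F n (C.orderEmbOfFin hC j) ^ q ^ (R.orderEmbOfFin hR i : ℕ)) := by
  subst hR
  simp [subDet, hC]

lemma subDet_range_sdiff (m : ℕ) (k : Fin (m + 1)) :
    subDet F (Fintype.card F) m (range (m + 1) \ {(k : ℕ)}) (range m) =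
      mooreMinor F (fun i => (k.succAbove i : ℕ)) (xV F m) := by
  have hR : (range (m + 1) \ {(k : ℕ)}).card = m := by
    rw [Finset.card_sdiff_of_subset (by simp [Nat.lt_succ_iff.1 k.2]), card_range, card_singleton,
      Nat.add_sub_cancel]
  have hC : (range m).card = m := card_range m
  have h1 : (fun i : Fin m => (k.succAbove i : ℕ)) = (range (m + 1) \ {(k : ℕ)}).orderEmbOfFin hR :=
    Finset.orderEmbOfFin_unique hR (fun i => by
      simp only [mem_sdiff, Finset.mem_range, mem_singleton, Fin.is_lt, true_and]
      exact fun h => Fin.succAbove_ne k i (Fin.ext h)) (fun i j h => Fin.strictMono_succAbove k h)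
  have h2 : (fun i : Fin m => (i : ℕ)) = (range m).orderEmbOfFin hC :=
    Finset.orderEmbOfFin_unique hC (by simp) (fun i j h => h)
  rw [subDet_eq_det _ _ hR hC, ← h1, ← h2]
  rfl

lemma linProd_eq_affProd (n a t : ℕ) : linProd F n a t = affProd F (xV F n) a (xV F n t) := by
  simp [linProd, affProd, MvPolynomial.smul_eq_C_mul]

lemma Lm_eq_moore (n m : ℕ) : Lm F n m = moore F m (xV F n) := by
  simp [Lm, moore_eq_prod, linProd_eq_affProd]

omit [Fintype F] in
lemma aeval_xV {m k : ℕ} (hk : k < m) (u : ℕ → A) :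
    aeval (R := F) (fun t : Fin m => u t) (xV F m k) = u k := by
  simp [xV, hk]

omit [Fintype F] in
lemma aeval_xV_self (m : ℕ) (f : SV F m) : aeval (fun t : Fin m => xV F m t) f = f := by
  simp [xV]

lemma aeval_Lm (m : ℕ) (u : ℕ → A) : aeval (fun t : Fin m => u t) (Lm F m m) = moore F m u := by
  rw [Lm_eq_moore, map_mooreMinor]
  exact mooreMinor_congr fun k hk => aeval_xV hk u

omit [Fintype F] in
lemma linearIndependent_xV (n : ℕ) : LinearIndependent F fun k : Fin n => xV F n k := by
  simpa [xV] using MvPolynomial.linearIndependent_X (Fin n) F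

section Dickson

variable {Q : (m : ℕ) → ℕ → SV F m} (hQ : DicksonProp F (Fintype.card F) Q)
include hQ

lemma dickson_mul_moore {m : ℕ} (k : Fin (m + 1)) (u : ℕ → A) :
    aeval (fun t : Fin m => u t) (Q m k) * moore F m u =
      mooreMinor F (fun i => (k.succAbove i : ℕ)) u := by
  rw [← aeval_Lm, ← map_mul, hQ m k (Nat.lt_succ_iff.1 k.2), subDet_range_sdiff, map_mooreMinor]
  exact mooreMinor_congr fun k hk => aeval_xV hk u

lemma affProd_eq_sum (m : ℕ) (u : ℕ → A) (y : A) :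
    affProd F u m y = ∑ k : Fin (m + 1), (-1) ^ (k + m : ℕ) *
      aeval (fun t : Fin m => u t) (Q m k) * y ^ Fintype.card F ^ (k : ℕ) := by
  have h : affProd F X m (X m : MvPolynomial ℕ F) = ∑ k : Fin (m + 1), (-1) ^ (k + m : ℕ) *
      aeval (fun t : Fin m => X (t : ℕ)) (Q m k) * X m ^ Fintype.card F ^ (k : ℕ) := by
    refine mul_left_cancel₀ (moore_ne_zero (linearIndependent_X_nat (F := F) m)) ?_
    rw [moore_mul_affProd, Finset.mul_sum]
    refine Finset.sum_congr rfl fun k _ => ?_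
    rw [← dickson_mul_moore hQ k]
    ring
  have hu : ∀ i < m, ((MvPolynomial.aeval (R := F) (Function.update u m y)) ∘ X) i = u i := by
    intro i hi
    simp [hi.ne]
  have h' := congrArg (MvPolynomial.aeval (Function.update u m y)) h
  rw [map_affProd, affProd_congr hu, map_sum] at h'
  simp only [aeval_X, Function.update_self] at h'
  rw [h']
  refine Finset.sum_congr rfl fun k _ => ?_
  simp only [map_mul, map_pow, map_neg, map_one, aeval_X, Function.update_self]
  congr 2
  rw [← AlgHom.comp_apply]
  congr 1
  ext t
  simp [t.2.ne]

lemma dickson_last (m : ℕ) : Q m m = 1 := by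
  have h := dickson_mul_moore hQ (Fin.last m) (xV F m)
  simp only [Fin.val_last, Fin.succAbove_last, Fin.val_castSucc] at h
  rw [aeval_xV_self] at h
  exact mul_right_cancel₀ (moore_ne_zero (linearIndependent_xV m)) (by rw [one_mul]; exact h)

lemma dickson_zero (m : ℕ) : Q m 0 = Lm F m m ^ (Fintype.card F - 1) := by
  have h := dickson_mul_moore hQ (0 : Fin (m + 1)) (xV F m)
  have hfr : mooreMinor F (fun i => ((0 : Fin (m + 1)).succAbove i : ℕ)) (xV F m) =
      moore F m (xV F m) ^ Fintype.card F := by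
    have := map_mooreMinor (FiniteField.frobeniusAlgHom F (SV F m)) (fun i : Fin m => (i : ℕ))
      (xV F m)
    rw [FiniteField.coe_frobeniusAlgHom] at this
    refine Eq.trans ?_ this.symm
    rw [mooreMinor, mooreMinor]
    congr 1
    ext1 i j
    simp [pow_succ', pow_mul]
  rw [aeval_xV_self, hfr, ← Nat.sub_add_cancel (Fintype.card_pos (α := F)), pow_succ] at h
  rw [Lm_eq_moore]
  exact mul_right_cancel₀ (moore_ne_zero (linearIndependent_xV m)) h

lemma exists_linearMap_eq_affProd (m : ℕ) (u : ℕ → A) :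
    ∃ L : A →ₗ[F] A, ∀ y, L y = affProd F u m y := by
  refine ⟨∑ k : Fin (m + 1), LinearMap.mulLeft F ((-1) ^ (k + m : ℕ) *
      aeval (fun t : Fin m => u t) (Q m k)) ∘ₗ
        (FiniteField.frobeniusAlgHom F A ^ (k : ℕ)).toLinearMap, fun y => ?_⟩
  rw [affProd_eq_sum hQ, LinearMap.sum_apply]
  refine Finset.sum_congr rfl fun k _ => ?_
  simp only [LinearMap.comp_apply, AlgHom.toLinearMap_apply, frobenius_pow_apply,
    LinearMap.mulLeft_apply]

lemma affProd_sum_smul {ι : Type*} (s : Finset ι) (m : ℕ) (u : ℕ → A) (c : ι → F) (y : ι → A) :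
    affProd F u m (∑ i ∈ s, c i • y i) = ∑ i ∈ s, c i • affProd F u m (y i) := by
  obtain ⟨L, hL⟩ := exists_linearMap_eq_affProd hQ m u
  simp only [← hL, map_sum, map_smul]

lemma affProd_add (a b : ℕ) (u : ℕ → A) (y : A) :
    affProd F u (a + b) y =
      affProd F (fun j => affProd F u a (u (a + j))) b (affProd F u a y) := by
  obtain ⟨L, hL⟩ := exists_linearMap_eq_affProd hQ a u
  have h : ∀ d : Fin b → F, (∑ j : Fin b, d j • affProd F u a (u (a + j))) + affProd F u a y =
      affProd F u a ((∑ j : Fin b, d j • u (a + j)) + y) := by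
    intro d
    simp only [← hL, map_add, map_sum, map_smul]
  conv_rhs => rw [affProd]
  simp only [h]
  simp only [affProd]
  rw [← (Fin.appendEquiv a b).prod_comp, Fintype.prod_prod_type_right]
  refine Finset.prod_congr rfl fun d _ => Finset.prod_congr rfl fun c _ => ?_
  simp [Fin.appendEquiv, Fin.sum_univ_add, add_assoc]

lemma aeval_dickson_transform [IsDomain A] {m : ℕ} (k : Fin (m + 1)) {g : Matrix (Fin m) (Fin m) F}
    (hg : g.det ≠ 0) {u v : ℕ → A} (hu : moore F m u ≠ 0) (h : ∀ j : Fin m, v j = ∑ i, g i j • u i) :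
    aeval (fun t : Fin m => v t) (Q m k) = aeval (fun t : Fin m => u t) (Q m k) := by
  have h1 := dickson_mul_moore hQ k v
  rw [moore, mooreMinor_transform _ g h, mooreMinor_transform _ g h, ← dickson_mul_moore hQ k u,
    mul_smul_comm] at h1
  exact mul_right_cancel₀ hu (smul_right_injective A hg h1)

end Dickson

lemma affProd_self (u : ℕ → A) {m k : ℕ} (hk : k < m) : affProd F u m (u k) = 0 := by
  refine Finset.prod_eq_zero (Finset.mem_univ (Pi.single ⟨k, hk⟩ (-1))) ?_
  simp [Pi.single_apply]

lemma exists_of_affProd_eq_zero [IsDomain A] {u : ℕ → A} {m : ℕ} {y : A} (h : affProd F u m y = 0) :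
    ∃ c : Fin m → F, y = ∑ k : Fin m, c k • u k := by
  obtain ⟨c, -, hc⟩ := Finset.prod_eq_zero_iff.1 h
  exact ⟨-c, by simpa using eq_neg_of_add_eq_zero_right hc⟩

section Parabolic

variable {n : ℕ} {I : Composition n}

lemma blkIdx_embedding (i : Fin I.length) (j : Fin (I.blocksFun i)) :
    blkIdx n I (I.embedding i j) = i := by
  have h : (range I.length).filter (fun k => I.sizeUpTo (k + 1) ≤ I.embedding i j) = range i := by
    ext k
    have he := I.coe_embedding i j
    rw [Finset.mem_filter, Finset.mem_range, Finset.mem_range]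
    constructor
    · rintro ⟨-, h⟩
      by_contra! hk
      have h1 := I.monotone_sizeUpTo (Nat.succ_le_succ hk)
      simp only [Nat.succ_eq_add_one, I.sizeUpTo_succ' i] at h1
      omega
    · intro hk
      exact ⟨hk.trans i.2, (I.monotone_sizeUpTo hk).trans (by omega)⟩
  rw [blkIdx, h, card_range]

lemma vij_eq_affProd (i : Fin I.length) (j : ℕ) :
    vij F n I i j = affProd F (xV F n) (I.sizeUpTo i) (xV F n (I.sizeUpTo i + j)) :=
  linProd_eq_affProd _ _ _

lemma map_vij (φ : SV F n →ₐ[F] B) (i : Fin I.length) (j : ℕ) :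
    φ (vij F n I i j) =
      affProd F (φ ∘ xV F n) (I.sizeUpTo i) (φ (xV F n (I.sizeUpTo i + j))) := by
  rw [vij_eq_affProd, map_affProd]

lemma map_theta (φ : SV F n →ₐ[F] B) (i : Fin I.length) :
    φ (theta F n I i) = moore F (I.blocksFun i) (φ ∘ vij F n I i) := by
  rw [theta, aeval_Lm, map_mooreMinor]

lemma map_qInv (Q : (m : ℕ) → ℕ → SV F m) (φ : SV F n →ₐ[F] B) (i : Fin I.length) (k : ℕ) :
    φ (qInv F n Q I i k) =
      aeval (fun t : Fin (I.blocksFun i) => (φ ∘ vij F n I i) t) (Q (I.blocksFun i) k) := by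
  rw [qInv, ← AlgHom.comp_apply, comp_aeval]
  rfl

omit [Fintype F] in
lemma coeff_xV {i : Fin n} {k : ℕ} :
    coeff (Finsupp.single i 1) (xV F n k) = if k = i then 1 else 0 := by
  classical
  by_cases hk : k < n
  · have : (⟨k, hk⟩ : Fin n) = i ↔ k = i := by rw [Fin.ext_iff]
    simp [xV, hk, MvPolynomial.coeff_X, Finsupp.single_left_inj, this]
  · simp [xV, hk, (show k ≠ i by omega)]

variable {Q : (m : ℕ) → ℕ → SV F m} (hQ : DicksonProp F (Fintype.card F) Q)
include hQ

lemma linearIndependent_vij (i : Fin I.length) :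
    LinearIndependent F fun j : Fin (I.blocksFun i) => vij F n I i j := by
  rw [Fintype.linearIndependent_iff]
  intro d hd j
  simp only [vij_eq_affProd, ← affProd_sum_smul hQ] at hd
  obtain ⟨c, hc⟩ := exists_of_affProd_eq_zero hd
  have h := congrArg (coeff (Finsupp.single (I.embedding i j) 1)) hc
  have he := I.coe_embedding i j
  simp only [coeff_sum, coeff_smul, coeff_xV, smul_eq_mul] at h
  rw [Finset.sum_eq_single j, Finset.sum_eq_zero] at h
  · simpa [he] using h
  · intro k _
    rw [if_neg (by omega), mul_zero]
  · intro k _ hk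
    rw [if_neg (by rw [Ne, Fin.ext_iff] at hk; omega), mul_zero]
  · simp

lemma moore_map_vij_ne_zero {φ : SV F n →ₐ[F] B} (hφ : Function.Injective φ) (i : Fin I.length) :
    moore F (I.blocksFun i) (φ ∘ vij F n I i) ≠ 0 := by
  rw [moore, ← map_mooreMinor]
  exact (map_ne_zero_iff φ hφ).2 (moore_ne_zero (linearIndependent_vij hQ i))

lemma affProd_sizeUpTo_succ (φ : SV F n →ₐ[F] B) (i : Fin I.length) (y : B) :
    affProd F (φ ∘ xV F n) (I.sizeUpTo (i + 1)) y = ∑ k : Fin (I.blocksFun i + 1),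
      (-1) ^ (k + I.blocksFun i : ℕ) * φ (qInv F n Q I i k) *
        affProd F (φ ∘ xV F n) (I.sizeUpTo i) y ^ Fintype.card F ^ (k : ℕ) := by
  rw [I.sizeUpTo_succ' i, affProd_add hQ, affProd_eq_sum hQ]
  refine Finset.sum_congr rfl fun k _ => ?_
  simp only [map_qInv, Function.comp_apply, map_vij]

lemma affProd_sizeUpTo_congr {φ ψ : SV F n →ₐ[F] B} {i : ℕ} (hi : i ≤ I.length)
    (h : ∀ a : Fin I.length, (a : ℕ) < i → ∀ k : Fin (I.blocksFun a + 1),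
      ψ (qInv F n Q I a k) = φ (qInv F n Q I a k)) (y : B) :
    affProd F (ψ ∘ xV F n) (I.sizeUpTo i) y = affProd F (φ ∘ xV F n) (I.sizeUpTo i) y := by
  induction i with
  | zero =>
    rw [I.sizeUpTo_zero]
    exact affProd_congr (fun k hk => absurd hk k.not_lt_zero) y
  | succ i ih =>
    have h1 := affProd_sizeUpTo_succ hQ φ ⟨i, hi⟩ y
    have h2 := affProd_sizeUpTo_succ hQ ψ ⟨i, hi⟩ y
    simp only at h1 h2
    rw [h1, h2, ih (Nat.le_of_succ_le hi) fun a ha => h a (ha.trans i.lt_succ_self)]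
    exact Finset.sum_congr rfl fun k _ => by rw [h ⟨i, hi⟩ i.lt_succ_self]

lemma qInv_last (i : Fin I.length) : qInv F n Q I i (I.blocksFun i) = 1 := by
  rw [qInv, dickson_last hQ, map_one]

lemma qInv_zero (i : Fin I.length) :
    qInv F n Q I i 0 = theta F n I i ^ (Fintype.card F - 1) := by
  rw [qInv, dickson_zero hQ, map_pow, theta]

omit hQ in
/-- The generators `θ_i` (at `(i, 0)`) and `q_{i,k}` (at `(i, k)`, `0 < k < n_i`). -/
def parabolicGen (Q : (m : ℕ) → ℕ → SV F m) (I : Composition n)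
    (x : Σ i : Fin I.length, Fin (I.blocksFun i)) : SV F n :=
  if (x.2 : ℕ) = 0 then theta F n I x.1 else qInv F n Q I x.1 x.2

omit hQ in
lemma theta_eq_parabolicGen (Q : (m : ℕ) → ℕ → SV F m) (i : Fin I.length) :
    theta F n I i = parabolicGen Q I ⟨i, ⟨0, I.one_le_blocksFun i⟩⟩ := by
  simp [parabolicGen]

lemma qInv_mem_adjoin (i : Fin I.length) (k : Fin (I.blocksFun i + 1)) :
    qInv F n Q I i k ∈ Algebra.adjoin F (Set.range (parabolicGen Q I)) := by
  rcases Fin.eq_castSucc_or_eq_last k with ⟨k, rfl⟩ | rfl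
  · by_cases hk : (k : ℕ) = 0
    · rw [Fin.val_castSucc, hk, qInv_zero hQ, theta_eq_parabolicGen Q]
      exact pow_mem (Algebra.subset_adjoin (Set.mem_range_self _)) _
    · exact Algebra.subset_adjoin (Set.mem_range.2 ⟨⟨i, k⟩, by simp [parabolicGen, hk]⟩)
  · rw [Fin.val_last, qInv_last hQ]
    exact one_mem _

lemma map_vij_of_blockTriangular {φ ψ : SV F n →ₐ[F] B} {i : Fin I.length}
    (h : ∀ y, affProd F (ψ ∘ xV F n) (I.sizeUpTo i) y = affProd F (φ ∘ xV F n) (I.sizeUpTo i) y)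
    {g : Matrix (Fin n) (Fin n) F} (hg : ∀ a b : Fin n, blkIdx n I b < blkIdx n I a → g a b = 0)
    (hψ : ∀ j, ψ (X j) = ∑ k, g k j • φ (X k)) (j : Fin (I.blocksFun i)) :
    ψ (vij F n I i j) =
      ∑ k, g (I.embedding i k) (I.embedding i j) • φ (vij F n I i k) := by
  have hx : ∀ (a : Fin I.length) (k : Fin (I.blocksFun a)),
      xV F n (I.sizeUpTo a + k) = X (I.embedding a k) := by
    intro a k
    rw [← I.coe_embedding a k, xV, dif_pos (I.embedding a k).2]
  rw [map_vij, h, hx, hψ, affProd_sum_smul hQ, ← I.blocksFinEquiv.sum_comp, Fintype.sum_sigma,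
    Finset.sum_eq_single i]
  · simp only [map_vij, hx]
    rfl
  · intro a _ hai
    refine Finset.sum_eq_zero fun k _ => ?_
    change g (I.embedding a k) _ • affProd F _ _ (φ (X (I.embedding a k))) = 0
    rcases lt_or_gt_of_ne hai with hlt | hgt
    · have hlt' : (I.embedding a k : ℕ) < I.sizeUpTo i := by
        have h1 := I.monotone_sizeUpTo (Nat.succ_le_of_lt (Fin.lt_def.1 hlt))
        rw [Nat.succ_eq_add_one, I.sizeUpTo_succ' a] at h1
        rw [I.coe_embedding]
        omega
      have h2 := affProd_self (F := F) (φ ∘ xV F n) hlt'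
      rw [I.coe_embedding, Function.comp_apply, hx] at h2
      rw [h2, smul_zero]
    · rw [hg _ _ (by rw [blkIdx_embedding, blkIdx_embedding]; exact hgt), zero_smul]
  · simp

lemma map_gen_of_mem_KIset [IsDomain B] {φ ψ : SV F n →ₐ[F] B} (hφ : Function.Injective φ)
    {g : Matrix (Fin n) (Fin n) F} (hg : g ∈ KIset F n I)
    (hψ : ∀ j, ψ (X j) = ∑ k, g k j • φ (X k)) (i : Fin I.length) :
    ψ (theta F n I i) = φ (theta F n I i) ∧
      ∀ k : Fin (I.blocksFun i + 1), ψ (qInv F n Q I i k) = φ (qInv F n Q I i k) := by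
  obtain ⟨i, hi⟩ := i
  induction i using Nat.strong_induction_on with
  | _ i ih =>
    have hv := map_vij_of_blockTriangular hQ (i := ⟨i, hi⟩)
      (affProd_sizeUpTo_congr hQ hi.le fun a ha => (ih a ha a.2).2) hg.2.1 hψ
    have hd := hg.2.2 ⟨i, hi⟩
    refine ⟨?_, fun k => ?_⟩
    · rw [map_theta, map_theta, moore, mooreMinor_transform (u := φ ∘ vij F n I ⟨i, hi⟩)
        (v := ψ ∘ vij F n I ⟨i, hi⟩) _ _ hv]
      exact (congrArg (· • moore F _ _) hd).trans (one_smul F _)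
    · rw [map_qInv, map_qInv]
      exact aeval_dickson_transform hQ k (hd.trans_ne one_ne_zero)
        (u := φ ∘ vij F n I ⟨i, hi⟩) (v := ψ ∘ vij F n I ⟨i, hi⟩)
        (moore_map_vij_ne_zero hQ hφ _) hv

lemma exists_mem_KIset_of_map_gen [IsDomain B] {φ ψ : SV F n →ₐ[F] B}
    (hφ : Function.Injective φ) (hψ : Function.Injective ψ)
    (h : ∀ x, ψ (parabolicGen Q I x) = φ (parabolicGen Q I x)) :
    ∃ g ∈ KIset F n I, ∀ j, ψ (X j) = ∑ k, g k j • φ (X k) := by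
  have hle : Algebra.adjoin F (Set.range (parabolicGen Q I)) ≤ AlgHom.equalizer ψ φ :=
    Algebra.adjoin_le (by rintro _ ⟨x, rfl⟩; exact h x)
  have haff : ∀ i ≤ I.length, ∀ y,
      affProd F (ψ ∘ xV F n) (I.sizeUpTo i) y = affProd F (φ ∘ xV F n) (I.sizeUpTo i) y :=
    fun i hi => affProd_sizeUpTo_congr hQ hi fun a _ k => hle (qInv_mem_adjoin hQ a k)
  have hex : ∀ j : Fin n, ∃ c : Fin (I.sizeUpTo (I.index j + 1)) → F,
      ψ (X j) = ∑ k, c k • φ (xV F n k) := by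
    intro j
    refine exists_of_affProd_eq_zero (u := φ ∘ xV F n) ?_
    rw [← haff _ (I.index j).2]
    have := affProd_self (F := F) (ψ ∘ xV F n) (I.lt_sizeUpTo_index_succ j)
    simpa [xV] using this
  choose c hc using hex
  let g : Matrix (Fin n) (Fin n) F := fun k j =>
    if hk : (k : ℕ) < I.sizeUpTo (I.index j + 1) then c j ⟨k, hk⟩ else 0
  have hg : ∀ j, ψ (X j) = ∑ k, g k j • φ (X k) := by
    intro j
    rw [hc]
    refine Finset.sum_of_injOn (Fin.castLE (I.sizeUpTo_le _)) (Fin.castLE_injective _).injOn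
      (by simp) ?_ ?_
    · intro k _ hk
      have : ¬ (k : ℕ) < I.sizeUpTo (I.index j + 1) :=
        fun h => hk ⟨⟨k, h⟩, by simp, rfl⟩
      simp [g, this]
    · intro k _
      have := k.2.trans_le (I.sizeUpTo_le _)
      simp [g, xV, this]
      rfl
  have htri : ∀ a b : Fin n, blkIdx n I b < blkIdx n I a → g a b = 0 := by
    intro a b hab
    rw [← I.embedding_comp_inv a, ← I.embedding_comp_inv b, blkIdx_embedding,
      blkIdx_embedding] at hab
    have h1 := (I.monotone_sizeUpTo (Nat.succ_le_of_lt hab)).trans (I.sizeUpTo_index_le a)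
    simp only [g]
    rw [dif_neg (by simpa using h1)]
  refine ⟨g, ⟨?_, htri, fun i => ?_⟩, hg⟩
  · rw [← Matrix.isUnit_iff_isUnit_det, ← Matrix.mulVec_injective_iff_isUnit]
    change Function.Injective g.mulVecLin
    rw [injective_iff_map_eq_zero]
    intro d hd
    have h1 : ψ (∑ j, d j • X j) = 0 := by
      simp only [map_sum, map_smul, hg, Finset.smul_sum, smul_smul]
      rw [Finset.sum_comm]
      refine Finset.sum_eq_zero fun k _ => ?_
      rw [← Finset.sum_smul]
      have h2 := congrFun hd k
      simp only [Matrix.mulVecLin_apply, Matrix.mulVec, dotProduct, Pi.zero_apply] at h2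
      simp only [mul_comm (d _), h2, zero_smul]
    have h2 := (map_eq_zero_iff ψ hψ).1 h1
    exact funext (Fintype.linearIndependent_iff.1 (MvPolynomial.linearIndependent_X (Fin n) F) d h2)
  · have hv := map_vij_of_blockTriangular hQ (haff i i.2.le) htri hg
    have h1 := hle (theta_eq_parabolicGen Q i ▸ Algebra.subset_adjoin ⟨_, rfl⟩ :
      theta F n I i ∈ Algebra.adjoin F (Set.range (parabolicGen Q I)))
    rw [AlgHom.mem_equalizer, map_theta, map_theta, moore,
      mooreMinor_transform (u := φ ∘ vij F n I i) (v := ψ ∘ vij F n I i) _ _ hv] at h1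
    have h2 := moore_map_vij_ne_zero hQ hφ i
    exact smul_left_injective F h2 (h1.trans (one_smul F _).symm)

end Parabolic

section Generation

omit [Fintype F] in
/-- Let `A ⊆ S` be domains with `A` integrally closed and `K` the fraction field of `S`. If `S` is
generated over `A` by the roots of a separable polynomial that splits in `S`, then an element
of `S` fixed by all `A`-embeddings `S → K` lies in `A`. -/
lemma mem_range_algebraMap_of_forall_algHom {A S L K κ : Type*} [CommRing A] [CommRing S]
    [Field L] [Field K] [Algebra A S] [Algebra A L] [Algebra A K] [Algebra S K] [Algebra L K]
    [IsScalarTower A S K] [IsScalarTower A L K] [IsFractionRing A L] [IsFractionRing S K]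
    [IsDomain A] [IsIntegrallyClosed A] [Fintype κ] {r : κ → S} (hr : Function.Injective r)
    {P : Polynomial A} (hPm : P.Monic)
    (hP : P.map (algebraMap A S) = ∏ c, (Polynomial.X - Polynomial.C (r c)))
    (hgen : Algebra.adjoin A (Set.range r) = ⊤) {f : S}
    (hf : ∀ ψ : S →ₐ[A] K, Function.Injective ψ → ψ f = algebraMap S K f) :
    f ∈ Set.range (algebraMap A S) := by
  have hinj : Function.Injective (algebraMap S K) := IsFractionRing.injective _ _
  have hPK : (P.map (algebraMap A L)).map (algebraMap L K) =
      ∏ c, (Polynomial.X - Polynomial.C (algebraMap S K (r c))) := by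
    rw [Polynomial.map_map, ← IsScalarTower.algebraMap_eq, IsScalarTower.algebraMap_eq A S K,
      ← Polynomial.map_map, hP, Polynomial.map_prod]
    simp
  have hsep : (P.map (algebraMap A L)).Separable := by
    rw [← Polynomial.separable_map (algebraMap L K), hPK, Polynomial.separable_prod_X_sub_C_iff]
    exact hinj.comp hr
  have hsplit : (P.map (algebraMap A L)).IsSplittingField L K := by
    rw [isSplittingField_iff_intermediateField]
    refine ⟨hPK ▸ Polynomial.Splits.prod fun c _ => Polynomial.Splits.X_sub_C _, ?_⟩
    rw [eq_top_iff]
    set M := IntermediateField.adjoin L ((P.map (algebraMap A L)).rootSet K)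
    have hS : ∀ g : S, algebraMap S K g ∈ M := by
      intro g
      have hg : g ∈ Algebra.adjoin A (Set.range r) := hgen ▸ Algebra.mem_top
      induction hg using Algebra.adjoin_induction with
      | mem g hg =>
        obtain ⟨c, rfl⟩ := hg
        refine IntermediateField.subset_adjoin _ _ ?_
        rw [Polynomial.mem_rootSet_of_ne hsep.ne_zero, Polynomial.aeval_def,
          ← Polynomial.eval_map, hPK, Polynomial.eval_prod]
        exact Finset.prod_eq_zero (Finset.mem_univ c) (by simp)
      | algebraMap a =>
        rw [← IsScalarTower.algebraMap_apply, IsScalarTower.algebraMap_apply A L K]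
        exact M.algebraMap_mem _
      | add f g _ _ hf hg => rw [map_add]; exact add_mem hf hg
      | mul f g _ _ hf hg => rw [map_mul]; exact mul_mem hf hg
    intro x _
    obtain ⟨a, b, -, rfl⟩ := IsFractionRing.div_surjective (A := S) x
    exact div_mem (hS a) (hS b)
  have := Polynomial.IsSplittingField.finiteDimensional K (P.map (algebraMap A L))
  have : IsGalois L K := .of_separable_splitting_field hsep
  have hfL : algebraMap S K f ∈ Set.range (algebraMap L K) := by
    rw [IsGalois.mem_range_algebraMap_iff_fixed]
    intro τ
    exact hf ((τ.toAlgHom.restrictScalars A).comp (IsScalarTower.toAlgHom A S K))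
      (τ.injective.comp hinj)
  obtain ⟨y, hy⟩ := hfL
  have hint : IsIntegral A f := by
    have hle : Algebra.adjoin A (Set.range r) ≤ integralClosure A S := by
      rw [Algebra.adjoin_le_iff]
      rintro _ ⟨c, rfl⟩
      refine ⟨P, hPm, ?_⟩
      rw [← Polynomial.eval_map, hP, Polynomial.eval_prod]
      exact Finset.prod_eq_zero (Finset.mem_univ c) (by simp)
    exact hle (hgen ▸ Algebra.mem_top)
  have hyint : IsIntegral A y := by
    rw [← isIntegral_algebraMap_iff (algebraMap L K).injective, hy]
    exact hint.algebraMap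
  obtain ⟨a, rfl⟩ := IsIntegrallyClosed.isIntegral_iff.1 hyint
  rw [← IsScalarTower.algebraMap_apply, IsScalarTower.algebraMap_apply A S K] at hy
  exact ⟨a, hinj hy⟩

variable {σ ι κ : Type} [Fintype κ] {t : ι → MvPolynomial σ F} {r : κ → MvPolynomial σ F}
  (hP : ∏ c, (Polynomial.X - Polynomial.C (r c)) ∈
    Polynomial.lifts (algebraMap (Algebra.adjoin F (Set.range t)) (MvPolynomial σ F)))
  (hX : ∀ j, X j ∈ Set.range r)
include hP hX

omit [Fintype F] in
lemma algebraicIndependent_of_prod_mem_lifts [Fintype σ] [Fintype ι]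
    (hcard : Fintype.card ι = Fintype.card σ) : AlgebraicIndependent F t := by
  obtain ⟨P, hP, -, hPm⟩ := Polynomial.lifts_and_natDegree_eq_and_monic hP
    (Polynomial.monic_prod_X_sub_C _ _)
  have hint : Algebra.IsIntegral (Algebra.adjoin F (Set.range t)) (MvPolynomial σ F) := by
    refine ⟨fun f => ?_⟩
    induction f using MvPolynomial.induction_on with
    | C a => exact isIntegral_algebraMap (x := algebraMap F (Algebra.adjoin F (Set.range t)) a)
    | add f g hf hg => exact hf.add hg
    | mul_X f j hf =>
      refine hf.mul ⟨P, hPm, ?_⟩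
      obtain ⟨c, hc⟩ := hX j
      rw [← Polynomial.eval_map, hP, Polynomial.eval_prod]
      exact Finset.prod_eq_zero (Finset.mem_univ c) (by simp [hc])
  refine (Algebra.IsAlgebraic.isTranscendenceBasis_of_le_trdeg_of_finite F t ?_).1
  rw [← (IsTranscendenceBasis.mvPolynomial σ F).cardinalMk_eq_trdeg, Cardinal.mk_fintype,
    Cardinal.mk_fintype, hcard]

omit [Fintype F] in
lemma mem_adjoin_of_forall_algHom (ht : AlgebraicIndependent F t) (hr : Function.Injective r)
    {f : MvPolynomial σ F}
    (hf : ∀ ψ : MvPolynomial σ F →ₐ[F] FractionRing (MvPolynomial σ F), Function.Injective ψ →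
      (∀ x, ψ (t x) = algebraMap _ _ (t x)) → ψ f = algebraMap _ _ f) :
    f ∈ Algebra.adjoin F (Set.range t) := by
  have : IsIntegrallyClosed (Algebra.adjoin F (Set.range t)) :=
    .of_equiv ht.aevalEquiv.toRingEquiv
  obtain ⟨P, hP, -, hPm⟩ := Polynomial.lifts_and_natDegree_eq_and_monic hP
    (Polynomial.monic_prod_X_sub_C _ _)
  have hgen : Algebra.adjoin (Algebra.adjoin F (Set.range t)) (Set.range r) = ⊤ := by
    rw [eq_top_iff]
    intro g _
    induction g using MvPolynomial.induction_on with
    | C a => exact Subalgebra.algebraMap_mem _ (algebraMap F (Algebra.adjoin F (Set.range t)) a)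
    | add f g hf hg => exact add_mem (hf trivial) (hg trivial)
    | mul_X f j hf => exact mul_mem (hf trivial) (Algebra.subset_adjoin (hX j))
  let := FractionRing.liftAlgebra (Algebra.adjoin F (Set.range t))
    (FractionRing (MvPolynomial σ F))
  have := FractionRing.isScalarTower_liftAlgebra (Algebra.adjoin F (Set.range t))
    (FractionRing (MvPolynomial σ F))
  obtain ⟨a, rfl⟩ := mem_range_algebraMap_of_forall_algHom
    (L := FractionRing (Algebra.adjoin F (Set.range t))) hr hPm hP hgen (f := f) fun ψ hψ =>
      hf (ψ.restrictScalars F) hψ fun x =>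
        ψ.commutes ⟨t x, Algebra.subset_adjoin (Set.mem_range_self x)⟩
  exact a.2

end Generation

section Invariants

variable {n : ℕ} {I : Composition n} {Q : (m : ℕ) → ℕ → SV F m}
  (hQ : DicksonProp F (Fintype.card F) Q)
include hQ

lemma affProd_sizeUpTo_mem_lifts {i : ℕ} (hi : i ≤ I.length) :
    affProd F ((Polynomial.CAlgHom : SV F n →ₐ[F] Polynomial (SV F n)) ∘ xV F n) (I.sizeUpTo i)
      Polynomial.X ∈ Polynomial.lifts
        (algebraMap (Algebra.adjoin F (Set.range (parabolicGen Q I))) (SV F n)) := by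
  induction i with
  | zero =>
    rw [I.sizeUpTo_zero]
    simpa [affProd] using Polynomial.X_mem_lifts _
  | succ i ih =>
    have h := affProd_sizeUpTo_succ hQ (Polynomial.CAlgHom : SV F n →ₐ[F] Polynomial (SV F n))
      ⟨i, hi⟩ Polynomial.X
    simp only at h
    rw [h]
    refine sum_mem fun k _ => mul_mem (mul_mem ?_ ?_) (pow_mem (ih (Nat.le_of_succ_le hi)) _)
    · have := Polynomial.C_mem_lifts
        (algebraMap (Algebra.adjoin F (Set.range (parabolicGen Q I))) (SV F n))
        ((-1) ^ (k + I.blocksFun ⟨i, hi⟩ : ℕ))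
      simpa using this
    · exact Polynomial.C_mem_lifts
        (algebraMap (Algebra.adjoin F (Set.range (parabolicGen Q I))) (SV F n))
        ⟨_, qInv_mem_adjoin hQ ⟨i, hi⟩ k⟩

lemma prod_X_sub_C_linear_mem_lifts :
    ∏ c : Fin n → F, (Polynomial.X - Polynomial.C (-∑ k, c k • (X k : SV F n))) ∈
      Polynomial.lifts
        (algebraMap (Algebra.adjoin F (Set.range (parabolicGen Q I))) (SV F n)) := by
  have h := affProd_sizeUpTo_mem_lifts hQ (I := I) le_rfl
  rw [I.sizeUpTo_length] at h
  convert h using 1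
  refine Finset.prod_congr rfl fun c _ => ?_
  have hc : ∑ k : Fin n, c k • (X k : SV F n) = ∑ k : Fin n, c k • xV F n k := by simp [xV]
  rw [hc, map_neg, sub_neg_eq_add, add_comm]
  congr 1
  exact (map_sum (Polynomial.CAlgHom : SV F n →ₐ[F] Polynomial (SV F n)) _ _).trans
    (Finset.sum_congr rfl fun k _ => map_smul _ _ _)

omit [Fintype F] hQ in
lemma X_mem_range_linear (j : Fin n) :
    X j ∈ Set.range fun c : Fin n → F => -∑ k, c k • (X k : SV F n) :=
  ⟨Pi.single j (-1), by simp [Pi.single_apply]⟩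

omit [Fintype F] hQ in
lemma injective_linear :
    Function.Injective fun c : Fin n → F => -∑ k, c k • (X k : SV F n) := fun c d h =>
  (MvPolynomial.linearIndependent_X (Fin n) F).fintypeLinearCombination_injective
    (by simpa [Fintype.linearCombination_apply] using h)

lemma algebraicIndependent_parabolicGen : AlgebraicIndependent F (parabolicGen Q I) :=
  algebraicIndependent_of_prod_mem_lifts (prod_X_sub_C_linear_mem_lifts hQ) X_mem_range_linear
    (Fintype.card_congr I.blocksFinEquiv)

omit [Fintype F] hQ in
lemma gAct_X (g : Matrix (Fin n) (Fin n) F) (j : Fin n) :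
    gAct F n g (X j) = ∑ k, g k j • X k := by
  simp [gAct, MvPolynomial.smul_eq_C_mul]

lemma adjoin_parabolicGen_le_invS :
    Algebra.adjoin F (Set.range (parabolicGen Q I)) ≤ invS F n (KIset F n I) := by
  rw [Algebra.adjoin_le_iff]
  rintro _ ⟨⟨i, k⟩, rfl⟩ g hg
  have h := map_gen_of_mem_KIset hQ (φ := AlgHom.id F (SV F n)) Function.injective_id hg
    (gAct_X g) i
  rw [parabolicGen]
  split_ifs
  · exact h.1
  · exact h.2 k.castSucc

lemma invS_le_adjoin_parabolicGen :
    invS F n (KIset F n I) ≤ Algebra.adjoin F (Set.range (parabolicGen Q I)) := by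
  intro f hf
  refine mem_adjoin_of_forall_algHom (prod_X_sub_C_linear_mem_lifts hQ) X_mem_range_linear
    (algebraicIndependent_parabolicGen hQ) injective_linear fun ψ hψ hgen => ?_
  obtain ⟨g, hg, hψX⟩ := exists_mem_KIset_of_map_gen hQ
    (φ := IsScalarTower.toAlgHom F (SV F n) (FractionRing (SV F n)))
    (IsFractionRing.injective _ _) hψ hgen
  have hcomp : ψ = (IsScalarTower.toAlgHom F (SV F n) (FractionRing (SV F n))).comp
      (gAct F n g) := by
    ext j
    rw [hψX, AlgHom.comp_apply, gAct_X]
    simp only [map_sum, map_smul]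
  rw [hcomp, AlgHom.comp_apply, hf g hg]
  rfl

end Invariants

end KIInvariants

/-- **Theorem 2.8(1)** (Wan–Wang, after Minh–Tùng). `S(V)^{K_I}` is a polynomial
algebra on the `n` generators `θ_1, q_{1,1}, …, q_{1,n_1−1}, …, θ_ℓ, q_{ℓ,1}, …,
q_{ℓ,n_ℓ−1}`: these are algebraically independent and generate `S(V)^{K_I}`. -/
theorem KI_invariants_polynomial_algebra
    (F : Type) [Field F] [Fintype F] (p r q n : ℕ)
    (hp : p.Prime) (hr : 0 < r) (hq : q = p ^ r) (hF : Fintype.card F = q)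
    (Q : (m : ℕ) → ℕ → SV F m) (hQ : DicksonProp F q Q)
    (I : Composition n) :
    let gen : (Σ i : Fin I.length, Fin (I.blocksFun i)) → SV F n := fun x =>
      if (x.2 : ℕ) = 0 then theta F n I x.1 else qInv F n Q I x.1 (x.2 : ℕ)
    AlgebraicIndependent F gen
    ∧ Algebra.adjoin F (Set.range gen) = invS F n (KIset F n I) := by
  subst hF
  exact ⟨algebraicIndependent_parabolicGen hQ,
    le_antisymm (adjoin_parabolicGen_le_invS hQ) (invS_le_adjoin_parabolicGen hQ)⟩
end
end

section
/- (S(V)⊗Λ(V))^{K_I} is a free module over S(V)^{K_I}, and it decomposes as the direct sum of S(V)^{K_I} and the S(V)^{K_I}-submodules M_{m_i;b_1,…,b_j}·S(V)^{K_I} over all 1 ≤ j ≤ n, 1 ≤ i ≤ ℓ with m_i ≥ j, and 0 ≤ b_1 < ⋯ < b_j ≤ m_i−1 with b_j ≥ m_{i−1}; equivalently, it is a free S(V)^{K_I}-module with basis consisting of 1 together with these elements M_{m_i;b_1,…,b_j}. -/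
open scoped TensorProduct
open MvPolynomial Finset

noncomputable section

section Moore

variable {F : Type} [Field F]

theorem sum_smul_pow_card [Fintype F] {R : Type*} [CommRing R] [Algebra F R] {ι : Type*} (s : Finset ι)
    (a : ι → F) (x : ι → R) (c : ℕ) :
    (∑ i ∈ s, a i • x i) ^ Fintype.card F ^ c = ∑ i ∈ s, a i • x i ^ Fintype.card F ^ c := by
  induction c with
  | zero => simp
  | succ c ih =>
    have h (y : R) : y ^ Fintype.card F = FiniteField.frobeniusAlgHom F R y := rfl
    simp_rw [pow_succ, pow_mul, ih, h, map_sum, map_smul]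

/-- The Moore determinant of `x_0, …, x_{n-1}`. -/
def mooreDet (F : Type) [Field F] [Fintype F] {R : Type*} [CommRing R] (x : ℕ → R) (n : ℕ) : R :=
  Matrix.det (Matrix.of fun i j : Fin n => x j ^ Fintype.card F ^ (i : ℕ))

theorem mooreDet_succ [Fintype F] {R : Type*} [CommRing R] [IsDomain R] [Algebra F R] (x : ℕ → R) (n : ℕ)
    (hx : Function.Injective fun a : Fin n → F => ∑ i, a i • x i) (h0 : mooreDet F x n ≠ 0) :
    mooreDet F x (n + 1) = mooreDet F x n * ∏ a : Fin n → F, (x n - ∑ i, a i • x i) := by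
  classical
  set q := Fintype.card F with hq
  have hq1 : 1 < q := Fintype.one_lt_card
  let A : R → Matrix (Fin (n + 1)) (Fin (n + 1)) R := fun z =>
    Matrix.of fun i j => (Fin.snoc (fun j : Fin n => x j) z : Fin (n + 1) → R) j ^ q ^ (i : ℕ)
  let cf : Fin (n + 1) → R := fun i =>
    (-1) ^ ((i : ℕ) + n) * Matrix.det (Matrix.of fun k j : Fin n => x j ^ q ^ (i.succAbove k : ℕ))
  let p : Polynomial R := ∑ i : Fin (n + 1), Polynomial.C (cf i) * Polynomial.X ^ q ^ (i : ℕ)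
  have hev (z : R) : p.eval z = (A z).det := by
    rw [Matrix.det_succ_column _ (Fin.last n)]
    simp only [p, Polynomial.eval_finsetSum, Polynomial.eval_mul, Polynomial.eval_C,
      Polynomial.eval_pow, Polynomial.eval_X]
    refine Finset.sum_congr rfl fun i _ => ?_
    have : (A z).submatrix i.succAbove (Fin.last n).succAbove =
        Matrix.of fun k j : Fin n => x j ^ q ^ (i.succAbove k : ℕ) := by
      ext k j
      simp [A]
    rw [this]
    simp only [cf, A, Matrix.of_apply, Fin.snoc_last, Fin.val_last]
    ring
  have hroot (a : Fin n → F) : p.eval (∑ i, a i • x i) = 0 := by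
    rw [hev]
    have h1 : (A (∑ i, a i • x i)) = (A 0).updateCol (Fin.last n)
        (fun k => ∑ i : Fin (n + 1), (Fin.snoc (fun i => algebraMap F R (a i)) 0 : Fin (n + 1) → R) i
          • (A 0) k i) := by
      ext k j
      refine Fin.lastCases ?_ (fun j => ?_) j
      · simpa [A, Fin.sum_univ_castSucc, q, Algebra.smul_def] using
          sum_smul_pow_card Finset.univ a (fun i : Fin n => x i) k
      · rw [Matrix.updateCol_ne (Fin.castSucc_lt_last j).ne]
        simp [A]
    rw [h1, Matrix.det_updateCol_sum]
    simp
  have hdeg : p.natDegree ≤ q ^ n := by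
    refine Polynomial.natDegree_sum_le_of_forall_le _ _ fun i _ => ?_
    refine (Polynomial.natDegree_C_mul_X_pow_le _ _).trans ?_
    exact Nat.pow_le_pow_right hq1.le (Nat.lt_succ_iff.1 i.2)
  have hlead : p.coeff (q ^ n) = mooreDet F x n := by
    simp only [p, Polynomial.finsetSum_coeff, Polynomial.coeff_C_mul_X_pow]
    rw [Finset.sum_eq_single (Fin.last n)]
    · simp only [Fin.val_last, if_true, cf, mooreDet, ← two_mul, pow_mul]
      simp [q]
    · intro i _ hi
      rw [if_neg]
      intro h
      exact hi (Fin.ext (Nat.pow_right_injective hq1 h).symm)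
    · simp
  have hdeg' : p.natDegree = q ^ n :=
    le_antisymm hdeg (Polynomial.le_natDegree_of_ne_zero (by rw [hlead]; exact h0))
  have hp0 : p ≠ 0 := by
    rintro h
    rw [h] at hlead
    exact h0 (by simpa using hlead.symm)
  have hcard : (Finset.univ.val.map fun a : Fin n → F => ∑ i, a i • x i).card = q ^ n := by
    simp [q]
  have hroots : p.roots = Finset.univ.val.map fun a : Fin n → F => ∑ i, a i • x i := by
    symm
    refine Multiset.eq_of_le_of_card_le ?_ ?_
    · rw [Multiset.le_iff_subset (Multiset.Nodup.map hx Finset.univ.nodup)]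
      intro r hr
      obtain ⟨a, -, rfl⟩ := Multiset.mem_map.1 hr
      rw [Polynomial.mem_roots hp0]
      exact hroot a
    · rw [hcard, ← hdeg']
      exact Polynomial.card_roots' p
  have key := Polynomial.C_leadingCoeff_mul_prod_multiset_X_sub_C (p := p)
    (by rw [hroots, hcard, hdeg'])
  have hlc : p.leadingCoeff = mooreDet F x n := by
    rw [Polynomial.leadingCoeff, hdeg', hlead]
  have h2 : mooreDet F x (n + 1) = p.eval (x n) := by
    rw [hev, mooreDet]
    congr 1
    ext i j
    refine Fin.lastCases ?_ (fun j => ?_) j <;> simp [A, q]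
  rw [h2, ← key, hlc, hroots, Multiset.map_map]
  rw [Polynomial.eval_mul, Polynomial.eval_C, Polynomial.eval_multiset_prod, Multiset.map_map]
  simp [Function.comp_def, -map_sum]

variable (N : ℕ)

/-- The linear form `∑_{t < n} a_t x_t`. -/
def linForm (F : Type) [Field F] (N n : ℕ) (a : ℕ → F) : SV F N :=
  ∑ t ∈ range n, a t • xV F N t

variable {N} {n : ℕ}

theorem coeff_linForm (hn : n ≤ N) (a : ℕ → F) (s : Fin N) (hs : (s : ℕ) < n) :
    MvPolynomial.coeff (Finsupp.single s 1) (linForm F N n a) = a s := by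
  rw [linForm, MvPolynomial.coeff_sum, Finset.sum_eq_single (s : ℕ)]
  · simp [xV, MvPolynomial.coeff_smul]
  · intro t ht hts
    have ht' : t < N := (Finset.mem_range.1 ht).trans_le hn
    rw [MvPolynomial.coeff_smul, xV, dif_pos ht', MvPolynomial.coeff_X, if_neg, smul_zero]
    intro h
    exact hts (congrArg Fin.val (Finsupp.single_left_injective one_ne_zero h))
  · simp [hs]

theorem linForm_smul_eq (hn : n ≤ N) {a b : ℕ → F} {c : F}
    (h : linForm F N n a = c • linForm F N n b) {t : ℕ} (ht : t < n) : a t = c * b t := by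
  have := congrArg (MvPolynomial.coeff (Finsupp.single (⟨t, ht.trans_le hn⟩ : Fin N) 1)) h
  rwa [MvPolynomial.coeff_smul, coeff_linForm hn _ _ ht, coeff_linForm hn _ _ ht,
    smul_eq_mul] at this

theorem irreducible_linForm (hn : n ≤ N) (a : ℕ → F) (ha : ∃ t < n, a t ≠ 0) :
    Irreducible (linForm F N n a) := by
  obtain ⟨t, ht, hat⟩ := ha
  have hc := coeff_linForm hn a ⟨t, ht.trans_le hn⟩ ht
  refine MvPolynomial.irreducible_of_totalDegree_eq_one (le_antisymm ?_ ?_) fun x hx => ?_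
  · refine MvPolynomial.totalDegree_finsetSum_le fun s hs => ?_
    refine (MvPolynomial.totalDegree_smul_le _ _).trans ?_
    rw [xV, dif_pos ((Finset.mem_range.1 hs).trans_le hn), MvPolynomial.totalDegree_X]
  · refine le_trans ?_ (MvPolynomial.le_totalDegree
      (s := Finsupp.single (⟨t, ht.trans_le hn⟩ : Fin N) 1) ?_)
    · simp
    · rw [MvPolynomial.mem_support_iff, hc]
      exact hat
  · refine isUnit_iff_ne_zero.2 ?_
    rintro rfl
    have := hx (Finsupp.single (⟨t, ht.trans_le hn⟩ : Fin N) 1)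
    rw [hc, zero_dvd_iff] at this
    exact hat this

theorem isRelPrime_linForm (hn : n ≤ N) (a b : ℕ → F) (ha : ∃ t < n, a t ≠ 0)
    (hb : ∃ t < n, b t ≠ 0) (hab : ∀ c : F, ∃ t < n, b t ≠ c * a t) :
    IsRelPrime (linForm F N n a) (linForm F N n b) := by
  rw [(irreducible_linForm hn a ha).isRelPrime_iff_not_dvd]
  intro h
  have has := (irreducible_linForm hn a ha).associated_of_dvd (irreducible_linForm hn b hb) h
  obtain ⟨u, hu⟩ := has
  obtain ⟨c, -, hc⟩ := MvPolynomial.isUnit_iff_eq_C_of_isReduced.1 u.isUnit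
  obtain ⟨t, ht, hne⟩ := hab c
  refine hne (linForm_smul_eq hn ?_ ht)
  rw [← hu, hc, MvPolynomial.smul_eq_C_mul, mul_comm]

/-- The coefficients of the linear form `x_i - ∑_{j < i} a_j x_j`. -/
def monicCoeffs (i : ℕ) (a : Fin i → F) (t : ℕ) : F :=
  if h : t < i then -a ⟨t, h⟩ else if t = i then 1 else 0

theorem linForm_monicCoeffs {i : ℕ} (hi : i < n) (a : Fin i → F) :
    linForm F N n (monicCoeffs i a) = xV F N i - ∑ j, a j • xV F N j := by
  rw [linForm, ← Finset.sum_subset (Finset.range_subset_range.2 (Nat.succ_le_of_lt hi)),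
    Finset.sum_range_succ, Finset.sum_range]
  · simp [monicCoeffs]
    abel
  · intro t _ ht
    simp only [Finset.mem_range, not_lt] at ht
    rw [monicCoeffs, dif_neg (by omega), if_neg (by omega), zero_smul]

theorem linForm_injective (hn : n ≤ N) :
    Function.Injective fun a : Fin n → F => ∑ i, a i • xV F N i := by
  intro a b hab
  have h (a : Fin n → F) : ∑ i, a i • xV F N i =
      linForm F N n (fun t => if h : t < n then a ⟨t, h⟩ else 0) := by
    rw [linForm, Finset.sum_range]
    simp
  simp only [h] at hab
  ext i
  have := linForm_smul_eq hn (hab.trans (one_smul F _).symm) i.2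
  simpa using this

theorem mooreDet_eq_prod [Fintype F] (hn : n ≤ N) :
    mooreDet F (xV F N) n ≠ 0 ∧ mooreDet F (xV F N) n =
      ∏ i ∈ range n, ∏ a : Fin i → F, (xV F N i - ∑ j, a j • xV F N j) := by
  induction n with
  | zero => simp [mooreDet]
  | succ n ih =>
    obtain ⟨h0, h1⟩ := ih (by omega)
    have h2 := mooreDet_succ (xV F N) n (linForm_injective (by omega)) h0
    refine ⟨?_, by rw [Finset.prod_range_succ, ← h1, h2]⟩
    rw [h2]
    refine mul_ne_zero h0 (Finset.prod_ne_zero_iff.2 fun a _ => ?_)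
    rw [← linForm_monicCoeffs (Nat.lt_succ_self n)]
    exact (irreducible_linForm hn _ ⟨n, by omega, by simp [monicCoeffs]⟩).ne_zero

theorem mooreDet_ne_zero [Fintype F] (hn : n ≤ N) : mooreDet F (xV F N) n ≠ 0 := (mooreDet_eq_prod hn).1

theorem mooreDet_dvd [Fintype F] (hn : n ≤ N) (s : SV F N)
    (h : ∀ a : ℕ → F, (∃ t < n, a t ≠ 0) → linForm F N n a ∣ s) :
    mooreDet F (xV F N) n ∣ s := by
  have hnz {i : ℕ} (hi : i < n) (a : Fin i → F) : ∃ t < n, monicCoeffs i a t ≠ 0 :=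
    ⟨i, hi, by simp [monicCoeffs]⟩
  rw [(mooreDet_eq_prod hn).2, ← Finset.prod_sigma (range n) (fun _ => Finset.univ)
    (fun x : (i : ℕ) × (Fin i → F) => xV F N x.1 - ∑ j, x.2 j • xV F N j)]
  refine Finset.prod_dvd_of_isRelPrime ?_ ?_
  · rintro ⟨i, a⟩ hi ⟨k, b⟩ hk hne
    simp only [Finset.coe_sigma, Set.mem_sigma_iff, Finset.coe_range, Set.mem_Iio] at hi hk
    simp only [Function.onFun]
    rw [← linForm_monicCoeffs hi.1, ← linForm_monicCoeffs hk.1]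
    refine isRelPrime_linForm hn _ _ (hnz hi.1 a) (hnz hk.1 b) fun c => ?_
    by_contra! hc
    have h1 := hc i hi.1
    have h2 := hc k hk.1
    obtain hik | rfl | hik := lt_trichotomy i k
    · simp [monicCoeffs, hik.not_gt, hik.ne'] at h2
    · simp only [monicCoeffs, lt_irrefl, dite_false, if_true, mul_one] at h1
      subst h1
      refine hne (congrArg _ (funext fun j => ?_))
      have := hc j (j.2.trans hi.1)
      simpa [monicCoeffs] using this.symm
    · have hc0 : c = 0 := by simpa [monicCoeffs, hik.not_gt, hik.ne'] using h1.symm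
      simp [hc0, monicCoeffs] at h2
  · rintro ⟨i, a⟩ hi
    simp only [Finset.mem_sigma, Finset.mem_range] at hi
    dsimp only
    rw [← linForm_monicCoeffs hi.1]
    exact h _ (hnz hi.1 a)

end Moore

section Contraction

variable {F : Type} [Field F] {N : ℕ}

/-- The exterior generator `y_t` in `S(V) ⊗ Λ(V)`. -/
def yT (F : Type) [Field F] (N t : ℕ) : SL F N := 1 ⊗ₜ[F] yV F N t

/-- The contraction `∂/∂y_t`. -/
def partialY (F : Type) [Field F] (N : ℕ) (t : Fin N) : SL F N →ₗ[SV F N] SL F N :=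
  LinearMap.baseChange (SV F N)
    (CliffordAlgebra.contractLeft (Q := (0 : QuadraticForm F (Fin N → F))) (LinearMap.proj t))

/-- The contraction with the vector `v`, the antiderivation with `y_t ↦ v_t`. -/
def contr (v : ℕ → SV F N) : SL F N →ₗ[SV F N] SL F N :=
  ∑ t : Fin N, v t • partialY F N t

/-- The augmentation `S(V) ⊗ Λ(V) → S(V)`. -/
def aug (F : Type) [Field F] (N : ℕ) : SL F N →ₐ[SV F N] SV F N :=
  Algebra.TensorProduct.lift (AlgHom.id _ _)
    ((Algebra.ofId F (SV F N)).comp ExteriorAlgebra.algebraMapInv) fun _ _ => Commute.all _ _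

theorem SL_mul_neg (f g : SL F N) : f * -g = -(f * g) :=
  (LinearMap.mulLeft (SV F N) f).map_neg g

theorem SL_neg_mul (f g : SL F N) : -f * g = -(f * g) :=
  (LinearMap.mulRight (SV F N) g).map_neg f

theorem yV_of_lt {t : ℕ} (ht : t < N) :
    yV F N t = ExteriorAlgebra.ι F (Pi.single (⟨t, ht⟩ : Fin N) (1 : F)) := dif_pos ht

theorem yT_mul_self (t : ℕ) : yT F N t * yT F N t = 0 := by
  rw [yT, Algebra.TensorProduct.tmul_mul_tmul, yV]
  split_ifs <;> simp

theorem yT_anticomm (s t : ℕ) : yT F N s * yT F N t = -(yT F N t * yT F N s) := by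
  simp only [yT, Algebra.TensorProduct.tmul_mul_tmul, yV]
  split_ifs
  · rw [eq_neg_iff_add_eq_zero, ← TensorProduct.tmul_add, ExteriorAlgebra.ι_add_mul_swap,
      TensorProduct.tmul_zero]
  all_goals simp

theorem yT_mul_yT_mul (t : ℕ) (f : SL F N) : yT F N t * (yT F N t * f) = 0 := by
  rw [← mul_assoc, yT_mul_self, zero_mul]

theorem yT_left_comm (s t : ℕ) (f : SL F N) :
    yT F N s * (yT F N t * f) = -(yT F N t * (yT F N s * f)) := by
  rw [← mul_assoc, yT_anticomm, SL_neg_mul, mul_assoc]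

theorem aug_yT (t : ℕ) : aug F N (yT F N t) = 0 := by
  rw [aug, yT, yV]
  split_ifs <;> simp [ExteriorAlgebra.algebraMapInv]

theorem aug_yT_mul (t : ℕ) (f : SL F N) : aug F N (yT F N t * f) = 0 := by
  rw [map_mul, aug_yT, zero_mul]

theorem partialY_one (t : Fin N) : partialY F N t 1 = 0 := by
  rw [partialY, Algebra.TensorProduct.one_def, LinearMap.baseChange_tmul,
    CliffordAlgebra.contractLeft_one, TensorProduct.tmul_zero]

theorem partialY_yT_mul {s : ℕ} (hs : s < N) (t : Fin N) (f : SL F N) :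
    partialY F N t (yT F N s * f) =
      (if s = t then f else 0) - yT F N s * partialY F N t f := by
  induction f using TensorProduct.induction_on with
  | zero => simp
  | add f g hf hg => rw [mul_add, map_add, hf, hg, map_add, mul_add]; split_ifs <;> abel
  | tmul a b =>
    simp only [partialY, yT, yV_of_lt hs, Algebra.TensorProduct.tmul_mul_tmul,
      LinearMap.baseChange_tmul, ExteriorAlgebra.ι, CliffordAlgebra.contractLeft_ι_mul]
    rw [TensorProduct.tmul_sub]
    congr 1
    by_cases h : s = t
    · subst h; simp
    · have : t ≠ ⟨s, hs⟩ := fun h' => h (by rw [h'])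
      simp [h, this]

theorem contr_add (v w : ℕ → SV F N) : contr (v + w) = contr v + contr w := by
  simp [contr, add_smul, Finset.sum_add_distrib]

theorem contr_one (v : ℕ → SV F N) : contr v (1 : SL F N) = 0 := by
  simp [contr, partialY_one]

theorem contr_yT_mul (v : ℕ → SV F N) {s : ℕ} (hs : s < N) (f : SL F N) :
    contr v (yT F N s * f) = v s • f - yT F N s * contr v f := by
  simp only [contr, LinearMap.sum_apply, LinearMap.smul_apply, partialY_yT_mul hs, smul_sub,
    Finset.sum_sub_distrib, Finset.mul_sum, mul_smul_comm]
  congr 1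
  rw [Finset.sum_eq_single (⟨s, hs⟩ : Fin N)]
  · simp
  · intro t _ ht
    rw [if_neg, smul_zero]
    rintro rfl
    exact ht rfl
  · simp

theorem contr_sum {ι : Type*} (s : Finset ι) (c : ι → SV F N) (v : ι → ℕ → SV F N) :
    contr (fun t => ∑ i ∈ s, c i * v i t) = ∑ i ∈ s, c i • contr (v i) := by
  simp only [contr, Finset.sum_smul, Finset.smul_sum, mul_smul]
  rw [Finset.sum_comm]

theorem contr_smul (c : SV F N) (v : ℕ → SV F N) : contr (fun t => c * v t) = c • contr v := by
  simpa using contr_sum {0} (fun _ : ℕ => c) (fun _ => v)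

/-- Induction on elements of `S(V) ⊗ Λ(V)` by left multiplication with generators. -/
theorem mem_of_yT_mul_mem (p : Submodule (SV F N) (SL F N)) (h1 : 1 ∈ p)
    (hy : ∀ t < N, ∀ f ∈ p, yT F N t * f ∈ p) (f : SL F N) : f ∈ p := by
  have key (b : LV F N) : (1 : SV F N) ⊗ₜ[F] b ∈ p := by
    induction b using CliffordAlgebra.left_induction with
    | algebraMap r =>
      have : (1 : SV F N) ⊗ₜ[F] (algebraMap F (LV F N) r) = (C r : SV F N) • (1 : SL F N) := by
        rw [Algebra.algebraMap_eq_smul_one, ← TensorProduct.smul_tmul,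
          Algebra.TensorProduct.one_def, TensorProduct.smul_tmul', smul_eq_mul, mul_one,
          MvPolynomial.smul_eq_C_mul, mul_one]
      exact this ▸ p.smul_mem _ h1
    | add x y hx hy => rw [TensorProduct.tmul_add]; exact p.add_mem hx hy
    | ι_mul x m hx =>
      have : (1 : SV F N) ⊗ₜ[F] (ExteriorAlgebra.ι F m * x) =
          ∑ t : Fin N, (C (m t) : SV F N) • (yT F N t * ((1 : SV F N) ⊗ₜ[F] x)) := by
        conv_lhs => rw [pi_eq_sum_univ' m, map_sum, Finset.sum_mul, TensorProduct.tmul_sum]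
        refine Finset.sum_congr rfl fun t _ => ?_
        rw [map_smul, yT, yV_of_lt t.2, Algebra.TensorProduct.tmul_mul_tmul,
          TensorProduct.smul_tmul', smul_mul_assoc, ← TensorProduct.smul_tmul,
          MvPolynomial.smul_eq_C_mul, smul_eq_mul, mul_one, mul_one, mul_one]
      exact this ▸ p.sum_mem fun t _ => p.smul_mem _ (hy t t.2 _ hx)
  induction f using TensorProduct.induction_on with
  | zero => exact p.zero_mem
  | add f g hf hg => exact p.add_mem hf hg
  | tmul a b =>
    have : a ⊗ₜ[F] b = a • ((1 : SV F N) ⊗ₜ[F] b) := by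
      rw [TensorProduct.smul_tmul', smul_eq_mul, mul_one]
    exact this ▸ p.smul_mem _ (key b)

theorem contr_contr (v : ℕ → SV F N) (f : SL F N) : contr v (contr v f) = 0 := by
  refine mem_of_yT_mul_mem (LinearMap.ker (contr v ∘ₗ contr v)) ?_ ?_ f
  · simp [contr_one]
  · intro t ht f hf
    rw [LinearMap.mem_ker, LinearMap.comp_apply] at hf ⊢
    rw [contr_yT_mul v ht, map_sub, map_smul, contr_yT_mul v ht, hf]
    simp

theorem contr_comm (v w : ℕ → SV F N) (f : SL F N) : contr v (contr w f) = -contr w (contr v f) := by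
  have h := contr_contr (v + w) f
  simp only [contr_add, LinearMap.add_apply, map_add, contr_contr, zero_add, add_zero] at h
  rw [eq_neg_iff_add_eq_zero, add_comm]
  exact h

theorem contr_mul_self (v : ℕ → SV F N) : contr v * contr v = 0 := LinearMap.ext (contr_contr v)

theorem contr_anticomm (v w : ℕ → SV F N) : contr v * contr w = -(contr w * contr v) :=
  LinearMap.ext (contr_comm v w)

/-- The submodule `S(V) ⊗ E[y_0, …, y_{m-1}]`. -/
def extSub (F : Type) [Field F] (N : ℕ) : ℕ → Submodule (SV F N) (SL F N)
  | 0 => Submodule.span _ {1}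
  | m + 1 => extSub F N m ⊔ (extSub F N m).map (LinearMap.mulLeft (SV F N) (yT F N m))

theorem mem_extSub_succ {m : ℕ} {f : SL F N} :
    f ∈ extSub F N (m + 1) ↔
      ∃ r ∈ extSub F N m, ∃ p ∈ extSub F N m, f = r + yT F N m * p := by
  rw [extSub, Submodule.mem_sup]
  constructor
  · rintro ⟨r, hr, _, ⟨p, hp, rfl⟩, rfl⟩
    exact ⟨r, hr, p, hp, rfl⟩
  · rintro ⟨r, hr, p, hp, rfl⟩
    exact ⟨r, hr, _, ⟨p, hp, rfl⟩, rfl⟩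

theorem extSub_mono {m n : ℕ} (h : m ≤ n) : extSub F N m ≤ extSub F N n :=
  monotone_nat_of_le_succ (f := extSub F N) (fun _ => le_sup_left) h

theorem one_mem_extSub (m : ℕ) : (1 : SL F N) ∈ extSub F N m :=
  extSub_mono (Nat.zero_le m) (Submodule.mem_span_singleton_self _)

theorem yT_mul_mem_extSub {m t : ℕ} (ht : t < m) {f : SL F N} (hf : f ∈ extSub F N m) :
    yT F N t * f ∈ extSub F N m := by
  induction m generalizing f with
  | zero => omega
  | succ m ih =>
    obtain ⟨r, hr, p, hp, rfl⟩ := mem_extSub_succ.1 hf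
    rw [mul_add, mem_extSub_succ]
    obtain rfl | htm := eq_or_ne t m
    · exact ⟨0, Submodule.zero_mem _, r, hr, by rw [yT_mul_yT_mul]; abel⟩
    · exact ⟨_, ih (by omega) hr, -(yT F N t * p), Submodule.neg_mem _ (ih (by omega) hp), by
        rw [yT_left_comm, SL_mul_neg]⟩

theorem mem_extSub_self (f : SL F N) : f ∈ extSub F N N :=
  mem_of_yT_mul_mem _ (one_mem_extSub N) (fun _ ht _ hf => yT_mul_mem_extSub ht hf) f

theorem contr_mem_extSub (v : ℕ → SV F N) {m : ℕ} (hm : m ≤ N) {f : SL F N}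
    (hf : f ∈ extSub F N m) : contr v f ∈ extSub F N m := by
  induction m generalizing f with
  | zero =>
    obtain ⟨s, rfl⟩ := Submodule.mem_span_singleton.1 hf
    rw [map_smul, contr_one, smul_zero]
    exact Submodule.zero_mem _
  | succ m ih =>
    obtain ⟨r, hr, p, hp, rfl⟩ := mem_extSub_succ.1 hf
    rw [map_add, contr_yT_mul v (by omega), mem_extSub_succ]
    exact ⟨_, Submodule.add_mem _ (ih (by omega) hr) (Submodule.smul_mem _ (v m) hp), _,
      Submodule.neg_mem _ (ih (by omega) hp), by rw [SL_mul_neg]; abel⟩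

theorem contr_congr {v w : ℕ → SV F N} {m : ℕ} (hm : m ≤ N) (h : ∀ t < m, v t = w t)
    {f : SL F N} (hf : f ∈ extSub F N m) : contr v f = contr w f := by
  induction m generalizing f with
  | zero =>
    obtain ⟨s, rfl⟩ := Submodule.mem_span_singleton.1 hf
    rw [map_smul, contr_one, map_smul, contr_one]
  | succ m ih =>
    obtain ⟨r, hr, p, hp, rfl⟩ := mem_extSub_succ.1 hf
    have ih' := fun {f} hf => ih (by omega) (fun t ht => h t (by omega)) (f := f) hf
    rw [map_add, map_add, contr_yT_mul v (by omega), contr_yT_mul w (by omega), ih' hr, ih' hp,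
      h m (by omega)]

theorem contr_single_eq_zero {n : ℕ} (hn : n ≤ N) {g : SL F N} (hg : g ∈ extSub F N n) :
    contr (Pi.single n 1) g = 0 := by
  rw [contr_congr (w := 0) hn (fun t ht => by simp [ht.ne]) hg]
  simp [contr]

/-- An element of `S(V) ⊗ E[y_0, …, y_{n-1}]` all of whose derivatives in directions `m ≤ b < n`
are divisible by `l` lies in `S(V) ⊗ E[y_0, …, y_{m-1}]` modulo `l`. -/
theorem mem_extSub_of_contr_mem {m n : ℕ} (hmn : m ≤ n) (hn : n ≤ N) (l : SV F N) {f : SL F N}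
    (hf : f ∈ extSub F N n)
    (h : ∀ b, m ≤ b → b < n → ∃ g, contr (Pi.single b 1) f = l • g) :
    ∃ r ∈ extSub F N m, ∃ g, f = r + l • g := by
  induction n, hmn using Nat.le_induction generalizing f with
  | base => exact ⟨f, hf, 0, by simp⟩
  | succ n hmn ih =>
    obtain ⟨r, hr, p, hp, rfl⟩ := mem_extSub_succ.1 hf
    obtain ⟨g₀, hg₀⟩ := h n hmn (by omega)
    rw [map_add, contr_yT_mul _ (by omega), contr_single_eq_zero (by omega) hr,
      contr_single_eq_zero (by omega) hp] at hg₀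
    simp only [Pi.single_eq_same, one_smul, mul_zero, sub_zero, zero_add] at hg₀
    obtain ⟨r', hr', g', hg'⟩ := ih (by omega) hr fun b hb hbn => by
      obtain ⟨g, hg⟩ := h b hb (by omega)
      refine ⟨g + yT F N n * contr (Pi.single b 1) g₀, ?_⟩
      rw [map_add, contr_yT_mul _ (by omega), hg₀] at hg
      rw [smul_add, ← hg, map_smul, mul_smul_comm]
      simp [hbn.ne']
    exact ⟨r', hr', g' + yT F N n * g₀, by rw [hg', hg₀, smul_add, mul_smul_comm, add_assoc]⟩

end Contraction

section SortedProd

variable {R : Type*} [Ring R]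

/-- The product of the `θ b` over `b ∈ B`, in increasing order. -/
def sortedProd {R : Type*} [Monoid R] (θ : ℕ → R) (B : Finset ℕ) : R :=
  ((B.sort (· ≤ ·)).map θ).prod

theorem sortedProd_empty {R : Type*} [Monoid R] (θ : ℕ → R) : sortedProd θ ∅ = 1 := by
  simp [sortedProd]

theorem sortedProd_insert {R : Type*} [Monoid R] (θ : ℕ → R) {a : ℕ} {B : Finset ℕ}
    (h : ∀ b ∈ B, a < b) :
    sortedProd θ (insert a B) = θ a * sortedProd θ B := by
  rw [sortedProd, Finset.sort_insert _ (fun b hb => (h b hb).le) fun ha => (h a ha).false,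
    List.map_cons, List.prod_cons, sortedProd]

variable {θ : ℕ → R} (hanti : ∀ a b, θ a * θ b = -(θ b * θ a))
include hanti

theorem mul_sortedProd_of_notMem {a : ℕ} {B : Finset ℕ} (ha : a ∉ B) :
    θ a * sortedProd θ B = sortedProd θ (insert a B) ∨
      θ a * sortedProd θ B = -sortedProd θ (insert a B) := by
  induction B using Finset.induction_on_min with
  | empty => left; rw [sortedProd_insert θ (by simp)]
  | insert b B hb ih =>
    obtain ⟨hab, haB⟩ := not_or.1 (mt Finset.mem_insert.2 ha)
    obtain h | h := lt_or_gt_of_ne hab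
    · left
      refine (sortedProd_insert θ fun c hc => ?_).symm
      obtain rfl | hc := Finset.mem_insert.1 hc
      exacts [h, h.trans (hb c hc)]
    · rw [sortedProd_insert θ hb, ← mul_assoc, hanti, neg_mul, mul_assoc, Finset.insert_comm,
        sortedProd_insert θ (a := b) (B := insert a B) (by simpa [h] using hb)]
      obtain h | h := ih haB <;> rw [h] <;> simp

theorem sortedProd_mul_of_disjoint {A B : Finset ℕ} (h : Disjoint A B) :
    sortedProd θ A * sortedProd θ B = sortedProd θ (A ∪ B) ∨
      sortedProd θ A * sortedProd θ B = -sortedProd θ (A ∪ B) := by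
  induction A using Finset.induction_on_min with
  | empty => simp [sortedProd_empty]
  | insert a A ha ih =>
    rw [Finset.disjoint_insert_left] at h
    have haA : a ∉ A := fun h' => (ha a h').false
    rw [sortedProd_insert θ ha, mul_assoc, Finset.insert_union]
    have := mul_sortedProd_of_notMem hanti (a := a) (B := A ∪ B) (by simp [haA, h.1])
    obtain h1 | h1 := ih h.2 <;> obtain h2 | h2 := this <;> rw [h1] <;> simp [h2]

variable (hsq : ∀ a, θ a * θ a = 0)
include hsq

theorem mul_sortedProd_of_mem {a : ℕ} {B : Finset ℕ} (ha : a ∈ B) :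
    θ a * sortedProd θ B = 0 := by
  induction B using Finset.induction_on_min with
  | empty => simp at ha
  | insert b B hb ih =>
    rw [sortedProd_insert θ hb, ← mul_assoc]
    obtain rfl | h := eq_or_ne a b
    · rw [hsq, zero_mul]
    · rw [hanti, neg_mul, mul_assoc, ih (Finset.mem_of_mem_insert_of_ne ha h), mul_zero, neg_zero]

theorem sortedProd_mul_of_not_disjoint {A B : Finset ℕ} (h : ¬Disjoint A B) :
    sortedProd θ A * sortedProd θ B = 0 := by
  induction A using Finset.induction_on_min with
  | empty => simp at h
  | insert a A ha ih =>
    rw [sortedProd_insert θ ha, mul_assoc]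
    by_cases hAB : Disjoint A B
    · have haB : a ∈ A ∪ B := Finset.mem_union_right _ <| by
        by_contra haB
        exact h (Finset.disjoint_insert_left.2 ⟨haB, hAB⟩)
      obtain h | h := sortedProd_mul_of_disjoint hanti hAB <;>
        simp [h, mul_sortedProd_of_mem hanti hsq haB]
    · rw [ih hAB, mul_zero]

end SortedProd

section Laplace

variable {F : Type} [Field F] {N : ℕ}

theorem one_tmul_yProd (S : Finset ℕ) :
    (1 : SV F N) ⊗ₜ[F] yProd F N S = sortedProd (yT F N) S := by
  have := map_list_prod (Algebra.TensorProduct.includeRight : LV F N →ₐ[F] SL F N)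
    ((S.sort (· ≤ ·)).map (yV F N))
  rw [List.map_map] at this
  exact this

theorem sortedProd_yT_mem_extSub {n : ℕ} {S : Finset ℕ} (hS : S ⊆ range n) :
    sortedProd (yT F N) S ∈ extSub F N n := by
  induction S using Finset.induction_on_min with
  | empty => exact sortedProd_empty (yT F N) ▸ one_mem_extSub n
  | insert a S ha ih =>
    rw [Finset.insert_subset_iff, Finset.mem_range] at hS
    exact sortedProd_insert (yT F N) ha ▸ yT_mul_mem_extSub hS.1 (ih hS.2)

theorem contr_sortedProd (v : ℕ → SV F N) {S : Finset ℕ} (hS : S ⊆ range N) :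
    contr v (sortedProd (yT F N) S) =
      ∑ s ∈ S, ((-1) ^ #{t ∈ S | t < s} * v s) • sortedProd (yT F N) (S.erase s) := by
  induction S using Finset.induction_on_min with
  | empty => simp [sortedProd_empty, contr_one]
  | insert a S ha ih =>
    have haS : a ∉ S := fun h => (ha a h).false
    rw [Finset.insert_subset_iff, Finset.mem_range] at hS
    rw [sortedProd_insert _ ha, contr_yT_mul v hS.1, ih hS.2, Finset.sum_insert haS,
      Finset.erase_insert haS, Finset.mul_sum, sub_eq_add_neg, ← Finset.sum_neg_distrib]
    congr 1
    · rw [Finset.card_eq_zero.2, pow_zero, one_mul]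
      refine Finset.filter_false_of_mem fun t ht => ?_
      obtain rfl | ht := Finset.mem_insert.1 ht
      exacts [lt_irrefl _, (ha t ht).not_gt]
    · refine Finset.sum_congr rfl fun s hs => ?_
      rw [Finset.filter_insert, if_pos (ha s hs), Finset.card_insert_of_notMem (by simp [haS]),
        Finset.erase_insert_of_ne (ha s hs).ne,
        sortedProd_insert _ fun b hb => ha b (Finset.mem_of_mem_erase hb), mul_smul_comm,
        pow_succ, mul_neg_one, neg_mul]
      exact (neg_smul _ _).symm

/-- The maximal minor with columns `C` of a matrix with rows `V 0, …, V (k - 1)`. -/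
def minor {R : Type*} [CommRing R] {k : ℕ} (V : Fin k → ℕ → R) (C : Finset ℕ) : R :=
  if h : #C = k then Matrix.det (Matrix.of fun i j => V i (C.orderEmbOfFin h j)) else 0

theorem card_filter_lt_orderEmbOfFin {k : ℕ} {C : Finset ℕ} (h : #C = k) (j : Fin k) :
    #{t ∈ C | t < C.orderEmbOfFin h j} = j := by
  have : {t ∈ C | t < C.orderEmbOfFin h j} = (Finset.Iio j).map (C.orderEmbOfFin h).toEmbedding := by
    ext t
    simp only [Finset.mem_filter, Finset.mem_map, Finset.mem_Iio]
    constructor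
    · rintro ⟨ht, hlt⟩
      rw [← Finset.map_orderEmbOfFin_univ C h] at ht
      obtain ⟨i, -, rfl⟩ := Finset.mem_map.1 ht
      exact ⟨i, by simpa using hlt, rfl⟩
    · rintro ⟨i, hi, rfl⟩
      exact ⟨Finset.orderEmbOfFin_mem _ _ _, by simpa using hi⟩
  rw [this, Finset.card_map, Fin.card_Iio]

theorem minor_succ {R : Type*} [CommRing R] {k : ℕ} (V : Fin (k + 1) → ℕ → R) {C : Finset ℕ}
    (h : #C = k + 1) :
    minor V C = ∑ s ∈ C, (-1) ^ #{t ∈ C | t < s} * V 0 s *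
      minor (fun i => V i.succ) (C.erase s) := by
  rw [minor, dif_pos h, Matrix.det_succ_row_zero]
  conv_rhs => rw [← Finset.map_orderEmbOfFin_univ C h, Finset.sum_map]
  refine Finset.sum_congr rfl fun j _ => ?_
  rw [Finset.map_orderEmbOfFin_univ]
  have hc : #(C.erase (C.orderEmbOfFin h j)) = k := by
    rw [Finset.card_erase_of_mem (Finset.orderEmbOfFin_mem _ _ _), h, Nat.add_sub_cancel]
  have he : ∀ i, C.orderEmbOfFin h (j.succAbove i) =
      (C.erase (C.orderEmbOfFin h j)).orderEmbOfFin hc i := by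
    refine congrFun (Finset.orderEmbOfFin_unique hc (f := fun i => C.orderEmbOfFin h (j.succAbove i))
      (fun i => ?_) ?_)
    · simp [Fin.succAbove_ne]
    · exact (C.orderEmbOfFin h).strictMono.comp (Fin.strictMono_succAbove j)
  have hcard := card_filter_lt_orderEmbOfFin h j
  simp only [RelEmbedding.coe_toEmbedding] at hcard ⊢
  rw [hcard, minor, dif_pos hc]
  congr 2
  ext i i'
  simp [he]

theorem prod_contr_sortedProd {n : ℕ} (hn : n ≤ N) {k : ℕ} (V : Fin k → ℕ → SV F N) :
    (List.ofFn fun i => contr (V i)).prod (sortedProd (yT F N) (range n)) =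
      ∑ C ∈ (range n).powersetCard k,
        ((-1) ^ (∑ s ∈ range n, s + ∑ s ∈ range n \ C, s) * minor V C) •
          sortedProd (yT F N) (range n \ C) := by
  induction k with
  | zero => simp [minor, ← two_mul]
  | succ k ih =>
    rw [List.ofFn_succ, List.prod_cons, Module.End.mul_apply, ih, map_sum]
    have hsub (C) : range n \ C ⊆ range N := Finset.sdiff_subset.trans (by simpa using hn)
    simp only [map_smul, contr_sortedProd _ (hsub _), Finset.smul_sum, smul_smul]
    have hr : ∀ C' ∈ (range n).powersetCard (k + 1),
        ((-1) ^ (∑ s ∈ range n, s + ∑ s ∈ range n \ C', s) * minor V C') •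
          sortedProd (yT F N) (range n \ C') =
        ∑ s ∈ C', ((-1) ^ (∑ s ∈ range n, s + ∑ s ∈ range n \ C', s) *
          ((-1) ^ #{t ∈ C' | t < s} * V 0 s * minor (fun i => V i.succ) (C'.erase s))) •
          sortedProd (yT F N) (range n \ C') := fun C' hC' => by
      rw [minor_succ V (Finset.mem_powersetCard.1 hC').2, Finset.mul_sum, Finset.sum_smul]
    rw [Finset.sum_congr rfl hr, Finset.sum_sigma', Finset.sum_sigma']
    refine Finset.sum_bij' (fun x _ => ⟨insert x.2 x.1, x.2⟩) (fun x _ => ⟨x.1.erase x.2, x.2⟩)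
      ?_ ?_ ?_ ?_ ?_
    · rintro ⟨C, s⟩ h
      simp only [Finset.mem_sigma, Finset.mem_powersetCard, Finset.mem_sdiff] at h ⊢
      exact ⟨⟨Finset.insert_subset h.2.1 h.1.1, by rw [Finset.card_insert_of_notMem h.2.2, h.1.2]⟩,
        Finset.mem_insert_self _ _⟩
    · rintro ⟨C, s⟩ h
      simp only [Finset.mem_sigma, Finset.mem_powersetCard, Finset.mem_sdiff] at h ⊢
      exact ⟨⟨(Finset.erase_subset _ _).trans h.1.1, by
        rw [Finset.card_erase_of_mem h.2, h.1.2, Nat.add_sub_cancel]⟩, h.1.1 h.2, by simp⟩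
    · rintro ⟨C, s⟩ h
      simp only [Finset.mem_sigma, Finset.mem_powersetCard, Finset.mem_sdiff] at h ⊢
      simp [h.2.2]
    · rintro ⟨C, s⟩ h
      simp only [Finset.mem_sigma, Finset.mem_powersetCard] at h ⊢
      simp [h.2]
    · rintro ⟨C, s⟩ h
      simp only [Finset.mem_sigma, Finset.mem_powersetCard, Finset.mem_sdiff] at h ⊢
      obtain ⟨⟨hC, hk⟩, hsn, hsC⟩ := h
      have h1 : (range n \ C).erase s = range n \ insert s C := by
        rw [Finset.sdiff_insert]
      have h2 : ∑ t ∈ range n \ C, t = ∑ t ∈ range n \ insert s C, t + s := by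
        rw [← h1, Finset.sum_erase_add _ _ (by simpa [hsC] using hsn)]
      have h3 : #{t ∈ range n \ C | t < s} + #{t ∈ insert s C | t < s} = s := by
        rw [← Finset.card_union_of_disjoint]
        · conv_rhs => rw [← Finset.card_range s]
          congr 1
          ext t
          have := @hC t
          simp only [Finset.mem_range] at this hsn
          simp only [Finset.mem_union, Finset.mem_filter, Finset.mem_sdiff, Finset.mem_insert,
            Finset.mem_range]
          grind
        · rw [Finset.disjoint_left]
          simp only [Finset.mem_filter, Finset.mem_sdiff, Finset.mem_insert]
          grind
      rw [h1, h2, Finset.erase_insert hsC]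
      congr 1
      generalize #{t ∈ range n \ C | t < s} = a at *
      generalize #{t ∈ insert s C | t < s} = b at *
      subst h3
      have : ((-1 : SV F N) ^ a) * (-1) ^ a = 1 := by rw [← mul_pow]; simp
      simp only [pow_add]
      linear_combination ((-1) ^ (∑ s ∈ range n, s) * (-1) ^ (∑ t ∈ range n \ insert (a + b) C, t)
        * (-1) ^ b * minor (fun i => V i.succ) C * V 0 (a + b)) * this

end Laplace

section Mui

variable {F : Type} [Field F] {N : ℕ}

theorem aug_sortedProd_yT {S : Finset ℕ} (hS : S.Nonempty) :
    aug F N (sortedProd (yT F N) S) = 0 := by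
  induction S using Finset.induction_on_min with
  | empty => simp at hS
  | insert a S ha ih => rw [sortedProd_insert _ ha, aug_yT_mul]

theorem neg_one_pow_mul_self {R : Type*} [CommRing R] (e : ℕ) :
    (-1 : R) ^ e * (-1 : R) ^ e = 1 := by
  rw [← mul_pow]; simp

variable [Fintype F]

/-- The contraction with the vector `(x_0 ^ q ^ c, x_1 ^ q ^ c, …)`. -/
def dFrob (F : Type) [Field F] [Fintype F] (N c : ℕ) : Module.End (SV F N) (SL F N) :=
  contr fun t => xV F N t ^ Fintype.card F ^ c

/-- The ordered product of the contractions `dFrob c` for `c ∈ B`. -/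
def dProd (F : Type) [Field F] [Fintype F] (N : ℕ) (B : Finset ℕ) :
    Module.End (SV F N) (SL F N) :=
  sortedProd (dFrob F N) B

/-- Mui's element, up to sign, written through contractions of `y_0 ⋯ y_{n-1}`. -/
def mui (F : Type) [Field F] [Fintype F] (N n : ℕ) (B : Finset ℕ) : SL F N :=
  dProd F N (range n \ B) (sortedProd (yT F N) (range n))

theorem dFrob_mul_self (a : ℕ) : dFrob F N a * dFrob F N a = 0 := contr_mul_self _

theorem dFrob_anticomm (a b : ℕ) : dFrob F N a * dFrob F N b = -(dFrob F N b * dFrob F N a) :=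
  contr_anticomm _ _

theorem dProd_mul_of_disjoint {A B : Finset ℕ} (h : Disjoint A B) :
    dProd F N A * dProd F N B = dProd F N (A ∪ B) ∨
      dProd F N A * dProd F N B = -dProd F N (A ∪ B) :=
  sortedProd_mul_of_disjoint (R := Module.End (SV F N) (SL F N)) dFrob_anticomm h

theorem dProd_mul_of_not_disjoint {A B : Finset ℕ} (h : ¬Disjoint A B) :
    dProd F N A * dProd F N B = 0 :=
  sortedProd_mul_of_not_disjoint (R := Module.End (SV F N) (SL F N)) dFrob_anticomm
    dFrob_mul_self h

theorem dProd_eq_prod_ofFn (R : Finset ℕ) :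
    dProd F N R = (List.ofFn fun i : Fin #R =>
      contr fun t => xV F N t ^ Fintype.card F ^ (R.orderEmbOfFin rfl i : ℕ)).prod := by
  rw [dProd, sortedProd]
  congr 1
  refine List.ext_getElem (by simp) fun i h1 h2 => ?_
  simp [dFrob, Finset.orderEmbOfFin_apply]

theorem dProd_range (n : ℕ) :
    dProd F N (range n) = (List.ofFn fun i : Fin n =>
      contr fun t => xV F N t ^ Fintype.card F ^ (i : ℕ)).prod := by
  rw [dProd, sortedProd, Finset.sort_range]
  congr 1
  refine List.ext_getElem (by simp) fun i h1 h2 => ?_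
  simp [dFrob]

theorem orderEmbOfFin_range {n : ℕ} (h : #(range n) = n) (i : Fin n) :
    (range n).orderEmbOfFin h i = i :=
  (congrFun (Finset.orderEmbOfFin_unique h (f := fun i : Fin n => (i : ℕ)) (by simp)
    fun _ _ h => h) i).symm

theorem exists_MuiM_eq_smul_mui {n : ℕ} (hn : n ≤ N) {B : Finset ℕ} (hB : B ⊆ range n) :
    ∃ u : SV F N, u * u = 1 ∧ MuiM F (Fintype.card F) N n B = u • mui F N n B := by
  refine ⟨(-1) ^ (#B * (#B + 1) / 2 + #B + ∑ s ∈ range n, s), neg_one_pow_mul_self _, ?_⟩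
  rw [mui, dProd_eq_prod_ofFn, prod_contr_sortedProd hn, MuiM, Finset.smul_sum]
  have hle := Finset.card_le_card hB
  rw [Finset.card_range] at hle
  have hcard {S : Finset ℕ} (hS : S ⊆ range n) : #(range n \ S) = n - #S := by
    rw [Finset.card_sdiff_of_subset hS, Finset.card_range]
  refine Finset.sum_bij' (fun S _ => range n \ S) (fun C _ => range n \ C) ?_ ?_ ?_ ?_ ?_
  · intro S hS
    rw [Finset.mem_powersetCard] at hS ⊢
    exact ⟨Finset.sdiff_subset, by rw [hcard hS.1, hS.2, hcard hB]⟩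
  · intro C hC
    rw [Finset.mem_powersetCard] at hC ⊢
    exact ⟨Finset.sdiff_subset, by rw [hcard hC.1, hC.2, hcard hB]; omega⟩
  · intro S hS
    exact Finset.sdiff_sdiff_eq_self (Finset.mem_powersetCard.1 hS).1
  · intro C hC
    exact Finset.sdiff_sdiff_eq_self (Finset.mem_powersetCard.1 hC).1
  · intro S hS
    rw [Finset.sdiff_sdiff_eq_self (Finset.mem_powersetCard.1 hS).1, ← one_tmul_yProd,
      TensorProduct.smul_tmul', TensorProduct.smul_tmul', TensorProduct.smul_tmul', subDet]
    congr 1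
    have := neg_one_pow_mul_self (R := SV F N) (∑ s ∈ range n, s)
    rw [Algebra.smul_def, map_pow, map_neg, map_one, smul_eq_mul, smul_eq_mul, mul_one]
    change _ * minor (fun i t => xV F N t ^ Fintype.card F ^ ((range n \ B).orderEmbOfFin rfl i : ℕ)) _ = _
    simp only [pow_add]
    linear_combination (-((-1) ^ (#B * (#B + 1) / 2) * (-1) ^ #B * (-1) ^ (∑ s ∈ S, s) *
      minor (fun i t => xV F N t ^ Fintype.card F ^ ((range n \ B).orderEmbOfFin rfl i : ℕ))
        (range n \ S))) * this

theorem aug_dProd_of_ne {n : ℕ} (hn : n ≤ N) {C : Finset ℕ} (hC : C ⊆ range n) (h : C ≠ range n) :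
    aug F N (dProd F N C (sortedProd (yT F N) (range n))) = 0 := by
  rw [dProd_eq_prod_ofFn, prod_contr_sortedProd hn, map_sum]
  refine Finset.sum_eq_zero fun C' hC' => ?_
  rw [Finset.mem_powersetCard] at hC'
  rw [map_smul, aug_sortedProd_yT, smul_zero]
  rw [Finset.sdiff_nonempty]
  intro h'
  exact h (Finset.eq_of_subset_of_card_le hC (hC'.2 ▸ Finset.card_le_card h'))

theorem aug_dProd_range {n : ℕ} (hn : n ≤ N) :
    ∃ u : SV F N, u * u = 1 ∧ aug F N (dProd F N (range n) (sortedProd (yT F N) (range n))) =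
      u * mooreDet F (xV F N) n := by
  refine ⟨(-1) ^ (∑ s ∈ range n, s), neg_one_pow_mul_self _, ?_⟩
  have hp : (range n).powersetCard n = {range n} := by
    simpa using Finset.powersetCard_self (range n)
  rw [dProd_range, prod_contr_sortedProd hn, hp, Finset.sum_singleton, minor,
    dif_pos (Finset.card_range n), sdiff_self, map_smul]
  simp [sortedProd_empty, orderEmbOfFin_range, mooreDet]

theorem aug_dProd_mui_of_ne {n : ℕ} (hn : n ≤ N) {A B : Finset ℕ} (hA : A ⊆ range n)
    (hB : B ⊆ range n) (h : A ≠ B) : aug F N (dProd F N A (mui F N n B)) = 0 := by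
  rw [mui, ← Module.End.mul_apply]
  by_cases hd : Disjoint A (range n \ B)
  · have hne : A ∪ range n \ B ≠ range n := fun h' => by
      refine h (Finset.Subset.antisymm ?_ ?_)
      · intro a ha
        by_contra haB
        exact Finset.disjoint_left.1 hd ha (Finset.mem_sdiff.2 ⟨hA ha, haB⟩)
      · intro b hb
        have := h' ▸ hB hb
        simpa [hb] using this
    have h0 := aug_dProd_of_ne (F := F) hn (Finset.union_subset hA Finset.sdiff_subset) hne
    obtain h | h := dProd_mul_of_disjoint (F := F) (N := N) hd <;> rw [h]
    · exact h0
    · rw [LinearMap.neg_apply, map_neg, h0, neg_zero]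
  · rw [dProd_mul_of_not_disjoint hd, LinearMap.zero_apply, map_zero]

theorem aug_dProd_mui_self {n : ℕ} (hn : n ≤ N) {B : Finset ℕ} (hB : B ⊆ range n) :
    ∃ u : SV F N, u * u = 1 ∧
      aug F N (dProd F N B (mui F N n B)) = u * mooreDet F (xV F N) n := by
  obtain ⟨u, hu, h0⟩ := aug_dProd_range (F := F) hn
  rw [mui, ← Module.End.mul_apply]
  obtain h | h := dProd_mul_of_disjoint (F := F) (N := N) (Finset.disjoint_sdiff (s := B) (t := range n)) <;>
    rw [h, Finset.union_sdiff_of_subset hB]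
  · exact ⟨u, hu, h0⟩
  · exact ⟨-u, by rw [neg_mul_neg, hu], by rw [LinearMap.neg_apply, map_neg, h0, neg_mul]⟩

end Mui

section Completeness

variable {F : Type} [Field F] [Fintype F] {N : ℕ}

/-- The `S(V)`-span of the operators `dProd A` for `A ⊆ {0, …, m - 1}`. -/
def dSpan (F : Type) [Field F] [Fintype F] (N m : ℕ) :
    Submodule (SV F N) (Module.End (SV F N) (SL F N)) :=
  Submodule.span _ (dProd F N '' {A | A ⊆ range m})

theorem dProd_mem_dSpan {m : ℕ} {A : Finset ℕ} (hA : A ⊆ range m) :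
    dProd F N A ∈ dSpan F N m := Submodule.subset_span ⟨A, hA, rfl⟩

theorem dProd_empty : dProd F N ∅ = 1 := sortedProd_empty _

theorem dProd_singleton (a : ℕ) : dProd F N {a} = dFrob F N a := by simp [dProd, sortedProd]

theorem dProd_mul_mem_dSpan {m : ℕ} {A B : Finset ℕ} (hA : A ⊆ range m) (hB : B ⊆ range m) :
    dProd F N A * dProd F N B ∈ dSpan F N m := by
  by_cases hd : Disjoint A B
  · have hAB := dProd_mem_dSpan (F := F) (N := N) (Finset.union_subset hA hB)
    obtain h | h := dProd_mul_of_disjoint (F := F) (N := N) hd <;> rw [h]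
    · exact hAB
    · have h' : -dProd F N (A ∪ B) = (-1 : SV F N) • dProd F N (A ∪ B) :=
        LinearMap.ext fun f => (neg_one_smul (SV F N) (dProd F N (A ∪ B) f)).symm
      rw [h']
      exact Submodule.smul_mem _ _ hAB
  · rw [dProd_mul_of_not_disjoint hd]
    exact Submodule.zero_mem _

theorem mul_mem_dSpan {m : ℕ} {P Q : Module.End (SV F N) (SL F N)} (hP : P ∈ dSpan F N m)
    (hQ : Q ∈ dSpan F N m) : P * Q ∈ dSpan F N m := by
  induction hP, hQ using Submodule.span_induction₂ with
  | mem_mem x y hx hy =>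
    obtain ⟨A, hA, rfl⟩ := hx
    obtain ⟨B, hB, rfl⟩ := hy
    exact dProd_mul_mem_dSpan hA hB
  | zero_left y hy => rw [zero_mul]; exact Submodule.zero_mem _
  | zero_right y hy => rw [mul_zero]; exact Submodule.zero_mem _
  | add_left x y z _ _ _ hx hy => rw [add_mul]; exact Submodule.add_mem _ hx hy
  | add_right x y z _ _ _ hx hy => rw [mul_add]; exact Submodule.add_mem _ hx hy
  | smul_left r x y _ _ h => rw [smul_mul_assoc]; exact Submodule.smul_mem _ r h
  | smul_right r x y _ _ h => rw [mul_smul_comm]; exact Submodule.smul_mem _ r h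

theorem dFrob_mem_dSpan {m a : ℕ} (ha : a < m) : dFrob F N a ∈ dSpan F N m :=
  dProd_singleton (F := F) (N := N) a ▸ dProd_mem_dSpan (by simpa using ha)

theorem dProd_apply_mem {U : Submodule (SV F N) (SL F N)}
    (hU : ∀ a, ∀ f ∈ U, dFrob F N a f ∈ U) (B : Finset ℕ) {f : SL F N} (hf : f ∈ U) :
    dProd F N B f ∈ U := by
  induction B using Finset.induction_on_min with
  | empty => rwa [dProd_empty]
  | insert b B hb ih =>
    rw [dProd, sortedProd_insert _ hb]
    exact hU b _ ih

theorem mui_mem_extSub {n : ℕ} (hn : n ≤ N) (B : Finset ℕ) : mui F N n B ∈ extSub F N n :=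
  dProd_apply_mem (fun _ _ hf => contr_mem_extSub _ hn hf) _
    (sortedProd_yT_mem_extSub (Finset.Subset.refl _))

theorem dSpan_apply_mem {U : Submodule (SV F N) (SL F N)}
    (hU : ∀ a, ∀ f ∈ U, dFrob F N a f ∈ U) {m : ℕ} {P : Module.End (SV F N) (SL F N)}
    (hP : P ∈ dSpan F N m) {f : SL F N} (hf : f ∈ U) : P f ∈ U := by
  induction hP using Submodule.span_induction with
  | mem x hx => obtain ⟨A, -, rfl⟩ := hx; exact dProd_apply_mem hU A hf
  | zero => exact U.zero_mem
  | add x y _ _ hx hy => exact U.add_mem hx hy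
  | smul r x _ hx => exact U.smul_mem r hx

theorem aug_dSpan_apply {m : ℕ} {f : SL F N} (hf : ∀ A ⊆ range m, aug F N (dProd F N A f) = 0)
    {P : Module.End (SV F N) (SL F N)} (hP : P ∈ dSpan F N m) : aug F N (P f) = 0 := by
  induction hP using Submodule.span_induction with
  | mem x hx => obtain ⟨A, hA, rfl⟩ := hx; exact hf A hA
  | zero => exact map_zero _
  | add x y _ _ hx hy => rw [LinearMap.add_apply, map_add, hx, hy, add_zero]
  | smul r x _ hx => rw [LinearMap.smul_apply, map_smul, hx, smul_zero]

theorem mooreDet_smul_contr_single {n : ℕ} (hn : n ≤ N) (t : Fin n) {h : SL F N}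
    (hh : h ∈ extSub F N n) :
    mooreDet F (xV F N) n • contr (Pi.single (t : ℕ) 1) h =
      ∑ b : Fin n, (Matrix.of fun i j : Fin n =>
        xV F N j ^ Fintype.card F ^ (i : ℕ)).adjugate t b • dFrob F N b h := by
  set A := Matrix.of fun i j : Fin n => xV F N j ^ Fintype.card F ^ (i : ℕ) with hA
  have h1 : ∑ b : Fin n, A.adjugate t b • dFrob F N b h =
      contr (fun s => ∑ b : Fin n, A.adjugate t b * xV F N s ^ Fintype.card F ^ (b : ℕ)) h := by
    rw [contr_sum, LinearMap.sum_apply]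
    rfl
  rw [h1, ← LinearMap.smul_apply, ← contr_smul]
  refine contr_congr hn (fun s hs => ?_) hh
  have := congrFun₂ A.adjugate_mul t ⟨s, hs⟩
  rw [Matrix.mul_apply] at this
  simp only [hA, Matrix.of_apply, Matrix.smul_apply] at this
  rw [this, mooreDet, Pi.single_apply, Matrix.one_apply, smul_eq_mul]
  simp [Fin.ext_iff, eq_comm]

theorem aug_dSpan_contr_single {n : ℕ} (hn : n ≤ N) {h : SL F N} (hh : h ∈ extSub F N n)
    (h0 : ∀ P ∈ dSpan F N n, aug F N (P h) = 0) {t : ℕ} (ht : t < n)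
    {P : Module.End (SV F N) (SL F N)} (hP : P ∈ dSpan F N n) :
    aug F N (P (contr (Pi.single t 1) h)) = 0 := by
  refine (mul_eq_zero.1 ?_).resolve_left (mooreDet_ne_zero (F := F) hn)
  rw [← smul_eq_mul, ← map_smul, ← map_smul, mooreDet_smul_contr_single hn ⟨t, ht⟩ hh,
    map_sum, map_sum]
  refine Finset.sum_eq_zero fun b _ => ?_
  rw [map_smul, map_smul, ← Module.End.mul_apply, h0 _ (mul_mem_dSpan hP (dFrob_mem_dSpan b.2)),
    smul_zero]

/-- An element of `S(V) ⊗ E[y_0, …, y_{n-1}]` is determined by the augmentations of its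
contractions. -/
theorem eq_zero_of_aug_dProd {n : ℕ} (hn : n ≤ N) {h : SL F N} (hh : h ∈ extSub F N n)
    (h0 : ∀ A ⊆ range n, aug F N (dProd F N A h) = 0) : h = 0 := by
  have key : ∀ k ≤ n, ∀ f ∈ extSub F N k, (∀ P ∈ dSpan F N n, aug F N (P f) = 0) → f = 0 := by
    intro k
    induction k with
    | zero =>
      intro _ f hf hP
      obtain ⟨s, rfl⟩ := Submodule.mem_span_singleton.1 hf
      have := hP 1 (dProd_empty (F := F) (N := N) ▸ dProd_mem_dSpan (Finset.empty_subset _))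
      rw [Module.End.one_apply, map_smul, map_one, smul_eq_mul, mul_one] at this
      rw [this, zero_smul]
    | succ k ih =>
      intro hk f hf hP
      have hf' := extSub_mono hk hf
      obtain ⟨r, hr, p, hp, rfl⟩ := mem_extSub_succ.1 hf
      have hp0 : p = 0 := by
        refine ih (by omega) p hp fun P hPn => ?_
        have := aug_dSpan_contr_single hn hf' hP (t := k) (by omega) hPn
        rwa [map_add, contr_yT_mul _ (by omega), contr_single_eq_zero (by omega) hr,
          contr_single_eq_zero (by omega) hp, Pi.single_eq_same, one_smul, mul_zero, sub_zero,
          zero_add] at this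
      subst hp0
      rw [mul_zero, add_zero] at hP ⊢
      exact ih (by omega) r hr hP
  exact key n le_rfl h hh fun P hP => aug_dSpan_apply h0 hP

theorem smul_eq_zero_SL {d : SV F N} (hd : d ≠ 0) {h : SL F N} (h0 : d • h = 0) : h = 0 := by
  refine eq_zero_of_aug_dProd le_rfl (mem_extSub_self h) fun A _ => ?_
  refine (mul_eq_zero.1 ?_).resolve_left hd
  rw [← smul_eq_mul, ← map_smul, ← map_smul, h0, map_zero, map_zero]

theorem mem_extSub_of_smul_mem {m n : ℕ} (hmn : m ≤ n) (hn : n ≤ N) {d : SV F N} (hd : d ≠ 0)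
    {h : SL F N} (hh : h ∈ extSub F N n) (hdh : d • h ∈ extSub F N m) : h ∈ extSub F N m := by
  obtain ⟨r, hr, g, hg⟩ := mem_extSub_of_contr_mem hmn hn 0 hh fun b hmb hbn => by
    refine ⟨0, ?_⟩
    rw [smul_zero]
    refine smul_eq_zero_SL hd ?_
    rw [← map_smul]
    exact contr_single_eq_zero (by omega) (extSub_mono hmb hdh)
  rw [hg, zero_smul, add_zero]
  exact hr

end Completeness

section Separation

theorem dvd_det_of_dvd_mulVec {R : Type*} [CommRing R] {n : ℕ} (M : Matrix (Fin n) (Fin n) R)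
    (c : Fin n → R) {s : Fin n} (hs : IsUnit (c s)) {l : R} (h : ∀ i, l ∣ (M.mulVec c) i) :
    l ∣ M.det := by
  have h1 : M.adjugate.mulVec (M.mulVec c) = M.det • c := by
    rw [Matrix.mulVec_mulVec, Matrix.adjugate_mul, Matrix.smul_mulVec, Matrix.one_mulVec]
  refine (hs.dvd_mul_right).1 ?_
  have h2 := congrFun h1 s
  rw [Pi.smul_apply, smul_eq_mul] at h2
  rw [← h2]
  exact Finset.dvd_sum (s := univ) fun i _ => (h i).mul_left _

variable {F : Type} [Field F] [Fintype F] {N : ℕ}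

theorem linForm_pow_card (n : ℕ) (a : ℕ → F) (c : ℕ) :
    linForm F N n a ^ Fintype.card F ^ c = ∑ t ∈ range n, a t • xV F N t ^ Fintype.card F ^ c :=
  sum_smul_pow_card _ _ _ _

/-- Modulo the first `m` variables, every Frobenius power row is a combination of the
first `m` ones. -/
theorem exists_frob_combination {m : ℕ} (hm : m ≤ N) (b : ℕ) :
    ∃ e : Fin m → SV F N, ∀ t < m, xV F N t ^ Fintype.card F ^ b =
      ∑ a : Fin m, e a * xV F N t ^ Fintype.card F ^ (a : ℕ) := by
  set A : Matrix (Fin m) (Fin m) (SV F N) :=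
    Matrix.of fun i j : Fin m => xV F N j ^ Fintype.card F ^ (i : ℕ) with hA
  set v : Fin m → SV F N := fun t => xV F N t ^ Fintype.card F ^ b with hv
  have hdvd (a : Fin m) : mooreDet F (xV F N) m ∣ (A.updateRow a v).det := by
    refine mooreDet_dvd hm _ fun c ⟨s, hs, hcs⟩ => ?_
    refine dvd_det_of_dvd_mulVec _ (fun t => C (c t)) (s := ⟨s, hs⟩)
      ((isUnit_iff_ne_zero.2 hcs).map C) fun i => ?_
    have key (k : ℕ) : linForm F N m c ∣
        ∑ t : Fin m, xV F N t ^ Fintype.card F ^ k * C (c t) := by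
      have h : ∑ t : Fin m, xV F N t ^ Fintype.card F ^ k * C (c t) =
          linForm F N m c ^ Fintype.card F ^ k := by
        rw [linForm_pow_card, Finset.sum_range]
        simp only [MvPolynomial.smul_eq_C_mul, mul_comm]
      rw [h]
      exact dvd_pow_self _ (pow_ne_zero _ Fintype.card_ne_zero)
    obtain rfl | hia := eq_or_ne i a
    · simpa [Matrix.mulVec, dotProduct, hv] using key b
    · simpa [Matrix.mulVec, dotProduct, hA, Matrix.updateRow_ne hia] using key i
  choose e he using hdvd
  refine ⟨e, fun t ht => mul_left_cancel₀ (mooreDet_ne_zero hm) ?_⟩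
  have h := congrFun (Matrix.mulVec_cramer A.transpose v) ⟨t, ht⟩
  rw [Matrix.det_transpose, Pi.smul_apply, smul_eq_mul] at h
  rw [Finset.mul_sum]
  refine h.symm.trans ?_
  rw [Matrix.mulVec, dotProduct]
  refine Finset.sum_congr rfl fun a _ => ?_
  rw [Matrix.cramer_transpose_apply, he, Matrix.transpose_apply, hA, Matrix.of_apply]
  ring

theorem exists_dSpan_eq_dProd {m : ℕ} (hm : m ≤ N) (B : Finset ℕ) :
    ∃ P ∈ dSpan F N m, ∀ f ∈ extSub F N m, dProd F N B f = P f := by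
  induction B using Finset.induction_on_min with
  | empty => exact ⟨_, dProd_mem_dSpan (Finset.empty_subset _), fun _ _ => rfl⟩
  | insert b B hb ih =>
    obtain ⟨P, hP, h⟩ := ih
    obtain ⟨e, he⟩ := exists_frob_combination (F := F) hm b
    refine ⟨∑ a : Fin m, e a • (dFrob F N a * P), Submodule.sum_mem _ fun a _ =>
      Submodule.smul_mem _ _ (mul_mem_dSpan (dFrob_mem_dSpan a.2) hP), fun f hf => ?_⟩
    have hPf := dSpan_apply_mem (fun a f hf => contr_mem_extSub _ hm hf) hP hf
    rw [dProd, sortedProd_insert _ hb, Module.End.mul_apply, ← dProd, h f hf, dFrob,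
      contr_congr hm he hPf, contr_sum, LinearMap.sum_apply, LinearMap.sum_apply]
    rfl

/-- The combination of the operators `dProd A`, `A ⊆ {0, …, m - 1}`, which agrees with `dProd B`
on `S(V) ⊗ E[y_0, …, y_{m-1}]`. -/
def dReduced (hm : m ≤ N) (B : Finset ℕ) : Module.End (SV F N) (SL F N) :=
  (exists_dSpan_eq_dProd hm B).choose

/-- The functional `f ↦ aug (dProd B f)` corrected so as to vanish on
`S(V) ⊗ E[y_0, …, y_{m-1}]`. -/
def psi (hm : m ≤ N) (B : Finset ℕ) : SL F N →ₗ[SV F N] SV F N :=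
  (aug F N).toLinearMap ∘ₗ (dProd F N B - dReduced hm B)

section

variable {m : ℕ} (hm : m ≤ N) (B : Finset ℕ)

theorem dReduced_mem_dSpan : dReduced (F := F) hm B ∈ dSpan F N m :=
  (exists_dSpan_eq_dProd hm B).choose_spec.1

theorem psi_apply (f : SL F N) :
    psi hm B f = aug F N (dProd F N B f) - aug F N (dReduced hm B f) := by
  rw [psi, LinearMap.comp_apply, LinearMap.sub_apply, map_sub]
  rfl

variable {B}

theorem psi_eq_zero {f : SL F N} (hf : f ∈ extSub F N m) : psi hm B f = 0 := by
  rw [psi_apply, (exists_dSpan_eq_dProd hm B).choose_spec.2 f hf, dReduced, sub_self]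

variable {n : ℕ} (hn : n ≤ N) (hmn : m ≤ n)
include hn hmn

theorem aug_dReduced_mui {B' : Finset ℕ} (hB' : B' ⊆ range n) (h : ¬B' ⊆ range m) :
    aug F N (dReduced hm B (mui F N n B')) = 0 :=
  aug_dSpan_apply (fun _ hA => aug_dProd_mui_of_ne hn
    (hA.trans (Finset.range_subset_range.2 hmn)) hB' fun h' => h (h' ▸ hA))
    (dReduced_mem_dSpan hm B)

theorem psi_mui_of_ne (hB : B ⊆ range n) {B' : Finset ℕ} (hB' : B' ⊆ range n)
    (h : ¬B' ⊆ range m) (hne : B ≠ B') : psi hm B (mui F N n B') = 0 := by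
  rw [psi_apply, aug_dReduced_mui hm hn hmn hB' h, aug_dProd_mui_of_ne hn hB hB' hne, sub_zero]

theorem psi_mui_self (hB : B ⊆ range n) (h : ¬B ⊆ range m) :
    ∃ u : SV F N, u * u = 1 ∧ psi hm B (mui F N n B) = u * mooreDet F (xV F N) n := by
  rw [psi_apply, aug_dReduced_mui hm hn hmn hB h, sub_zero]
  exact aug_dProd_mui_self hn hB

theorem mem_extSub_of_psi_eq_zero {h : SL F N} (hh : h ∈ extSub F N n)
    (h0 : ∀ B ⊆ range n, ¬B ⊆ range m → psi hm B h = 0) : h ∈ extSub F N m := by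
  have hex (A : {A // A ⊆ range m}) := aug_dProd_mui_self (F := F) hm A.2
  choose u hu huA using hex
  set g : SL F N := ∑ A ∈ (range m).powerset.attach,
    (u ⟨A, Finset.mem_powerset.1 A.2⟩ * aug F N (dProd F N A h)) • mui F N m A with hg
  have hgm : g ∈ extSub F N m := Submodule.sum_mem _ fun A _ =>
    Submodule.smul_mem _ _ (mui_mem_extSub hm A)
  have hgA : ∀ A ⊆ range m, aug F N (dProd F N A g) =
      mooreDet F (xV F N) m * aug F N (dProd F N A h) := by
    intro A hA
    rw [hg, map_sum, map_sum, Finset.sum_eq_single ⟨A, Finset.mem_powerset.2 hA⟩]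
    · rw [map_smul, map_smul, huA ⟨A, hA⟩, smul_eq_mul]
      linear_combination (aug F N (dProd F N A h) * mooreDet F (xV F N) m) * hu ⟨A, hA⟩
    · intro A' _ hne
      rw [map_smul, map_smul, aug_dProd_mui_of_ne hm hA (Finset.mem_powerset.1 A'.2)
        fun h => hne (Subtype.ext h.symm), smul_zero]
    · simp
  have hzero : mooreDet F (xV F N) m • h - g = 0 := by
    have hm0 : ∀ A ⊆ range m, aug F N (dProd F N A (mooreDet F (xV F N) m • h - g)) = 0 := by
      intro A hA
      rw [map_sub, map_sub, hgA A hA, map_smul, map_smul, smul_eq_mul, sub_self]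
    refine eq_zero_of_aug_dProd hn (Submodule.sub_mem _ (Submodule.smul_mem _ _ hh)
      (extSub_mono hmn hgm)) fun B hB => ?_
    by_cases hBm : B ⊆ range m
    · exact hm0 B hBm
    · have h1 : psi hm B (mooreDet F (xV F N) m • h - g) = 0 := by
        rw [map_sub, map_smul, h0 B hB hBm, psi_eq_zero hm hgm, smul_zero, sub_zero]
      rwa [psi_apply, aug_dSpan_apply hm0 (dReduced_mem_dSpan hm B), sub_zero] at h1
  refine mem_extSub_of_smul_mem hmn hn (mooreDet_ne_zero (F := F) hm) hh ?_
  rw [sub_eq_zero.1 hzero]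
  exact hgm

end

end Separation

section LinearForms

variable {F : Type} [Field F] {N : ℕ}

/-- The linear form `∑ a_t y_t` in the exterior generators. -/
def yForm (F : Type) [Field F] (N n : ℕ) (a : ℕ → F) : SL F N :=
  ∑ t ∈ range n, (C (a t) : SV F N) • yT F N t

/-- The ideal generated by the linear forms with coefficients `a` in the `x_t` and the `y_t`. -/
def formIdeal (F : Type) [Field F] (N n : ℕ) (a : ℕ → F) : Submodule (SV F N) (SL F N) :=
  LinearMap.range (LinearMap.mulLeft (SV F N) (yForm F N n a)) ⊔
    LinearMap.range (LinearMap.lsmul (SV F N) (SL F N) (linForm F N n a))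

variable {n : ℕ} {a : ℕ → F}

theorem mem_formIdeal {f : SL F N} :
    f ∈ formIdeal F N n a ↔ ∃ g h, f = yForm F N n a * g + linForm F N n a • h := by
  rw [formIdeal, Submodule.mem_sup]
  constructor
  · rintro ⟨_, ⟨g, rfl⟩, _, ⟨h, rfl⟩, rfl⟩
    exact ⟨g, h, rfl⟩
  · rintro ⟨g, h, rfl⟩
    exact ⟨_, ⟨g, rfl⟩, _, ⟨h, rfl⟩, rfl⟩

theorem contr_yForm_mul (hn : n ≤ N) (v : ℕ → SV F N) (f : SL F N) :
    contr v (yForm F N n a * f) =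
      (∑ t ∈ range n, C (a t) * v t) • f - yForm F N n a * contr v f := by
  rw [yForm, Finset.sum_mul, map_sum, Finset.sum_mul, Finset.sum_smul, ← Finset.sum_sub_distrib]
  refine Finset.sum_congr rfl fun t ht => ?_
  rw [smul_mul_assoc, map_smul, contr_yT_mul v ((Finset.mem_range.1 ht).trans_le hn), smul_sub,
    smul_smul, smul_mul_assoc]

theorem sum_C_mul_single {s : ℕ} (hs : s < n) (has : a s ≠ 0) :
    ∑ t ∈ range n, C (a t) * (Pi.single s (C (a s)⁻¹) : ℕ → SV F N) t = 1 := by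
  rw [Finset.sum_eq_single s]
  · rw [Pi.single_eq_same, ← C_mul, mul_inv_cancel₀ has, C_1]
  · intro t _ hts
    rw [Pi.single_eq_of_ne hts, mul_zero]
  · simp [hs]

theorem yForm_mul_sortedProd : yForm F N n a * sortedProd (yT F N) (range n) = 0 := by
  rw [yForm, Finset.sum_mul]
  refine Finset.sum_eq_zero fun t ht => ?_
  rw [smul_mul_assoc, mul_sortedProd_of_mem (R := SL F N) yT_anticomm yT_mul_self ht, smul_zero]

theorem sortedProd_mem_formIdeal (hn : n ≤ N) (ha : ∃ t < n, a t ≠ 0) :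
    sortedProd (yT F N) (range n) ∈ formIdeal F N n a := by
  obtain ⟨s, hs, has⟩ := ha
  have h := contr_yForm_mul (a := a) hn (Pi.single s (C (a s)⁻¹)) (sortedProd (yT F N) (range n))
  rw [yForm_mul_sortedProd, map_zero, sum_C_mul_single hs has, one_smul] at h
  exact mem_formIdeal.2 ⟨_, 0, by rw [smul_zero, add_zero]; exact sub_eq_zero.1 h.symm⟩

theorem aug_dvd_of_mem_formIdeal {f : SL F N} (hf : f ∈ formIdeal F N n a) :
    linForm F N n a ∣ aug F N f := by
  obtain ⟨g, h, rfl⟩ := mem_formIdeal.1 hf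
  have h0 : aug F N (yForm F N n a) = 0 := by simp [yForm, aug_yT]
  rw [map_add, map_mul, h0, zero_mul, zero_add, map_smul, smul_eq_mul]
  exact dvd_mul_right _ _

variable [Fintype F]

theorem dFrob_mem_formIdeal (hn : n ≤ N) (c : ℕ) {f : SL F N} (hf : f ∈ formIdeal F N n a) :
    dFrob F N c f ∈ formIdeal F N n a := by
  obtain ⟨g, h, rfl⟩ := mem_formIdeal.1 hf
  have hl : ∑ t ∈ range n, C (a t) * xV F N t ^ Fintype.card F ^ c =
      linForm F N n a * linForm F N n a ^ (Fintype.card F ^ c - 1) := by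
    rw [mul_pow_sub_one (pow_ne_zero _ Fintype.card_ne_zero), linForm_pow_card]
    simp only [MvPolynomial.smul_eq_C_mul]
  rw [dFrob, map_add, contr_yForm_mul hn, map_smul, hl, mem_formIdeal]
  refine ⟨-contr (fun t => xV F N t ^ Fintype.card F ^ c) g,
    linForm F N n a ^ (Fintype.card F ^ c - 1) • g +
      contr (fun t => xV F N t ^ Fintype.card F ^ c) h, ?_⟩
  rw [SL_mul_neg, smul_add, mul_smul]
  abel

theorem mui_mem_formIdeal (hn : n ≤ N) (ha : ∃ t < n, a t ≠ 0) (B : Finset ℕ) :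
    mui F N n B ∈ formIdeal F N n a :=
  dProd_apply_mem (fun c _ hf => dFrob_mem_formIdeal hn c hf) _ (sortedProd_mem_formIdeal hn ha)

theorem psi_dvd_of_mem_formIdeal {m : ℕ} (hm : m ≤ N) (hn : n ≤ N) (B : Finset ℕ) {f : SL F N}
    (hf : f ∈ formIdeal F N n a) : linForm F N n a ∣ psi hm B f := by
  have hU := fun c (f : SL F N) (hf : f ∈ formIdeal F N n a) => dFrob_mem_formIdeal hn c hf
  rw [psi_apply]
  exact dvd_sub (aug_dvd_of_mem_formIdeal (dProd_apply_mem hU _ hf))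
    (aug_dvd_of_mem_formIdeal (dSpan_apply_mem hU (dReduced_mem_dSpan hm B) hf))

end LinearForms

section Blocks

variable {F : Type} [Field F] {N : ℕ}

theorem formIdeal_eq_of_le {n n' : ℕ} (h : n ≤ n') (a : ℕ → F) :
    formIdeal F N n a = formIdeal F N n' (fun t => if t < n then a t else 0) := by
  have key {M : Type} [AddCommMonoid M] (g h' : ℕ → M) (h1 : ∀ t < n, g t = h' t)
      (h2 : ∀ t, n ≤ t → h' t = 0) : ∑ t ∈ range n, g t = ∑ t ∈ range n', h' t := by
    rw [← Finset.sum_subset (Finset.range_subset_range.2 h)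
      fun t _ ht => h2 t (by simpa using ht)]
    exact Finset.sum_congr rfl fun t ht => h1 t (Finset.mem_range.1 ht)
  have e1 : yForm F N n a = yForm F N n' fun t => if t < n then a t else 0 :=
    key (fun t => (C (a t) : SV F N) • yT F N t)
      (fun t => (C (if t < n then a t else 0) : SV F N) • yT F N t)
      (fun t ht => by simp only [if_pos ht])
      fun t ht => by simp only [if_neg ht.not_gt, C_0, zero_smul]
  have e2 : linForm F N n a = linForm F N n' fun t => if t < n then a t else 0 :=
    key (fun t => a t • xV F N t) (fun t => (if t < n then a t else 0) • xV F N t)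
      (fun t ht => by simp only [if_pos ht])
      fun t ht => by simp only [if_neg ht.not_gt, zero_smul]
  rw [formIdeal, formIdeal, e1, e2]

variable [Fintype F]

section

variable {n : ℕ} (hn : n ≤ N)
include hn

theorem MuiM_mem_extSub {B : Finset ℕ} (hB : B ⊆ range n) :
    MuiM F (Fintype.card F) N n B ∈ extSub F N n := by
  obtain ⟨u, -, h⟩ := exists_MuiM_eq_smul_mui (F := F) hn hB
  exact h ▸ Submodule.smul_mem _ _ (mui_mem_extSub hn B)

theorem MuiM_mem_formIdeal {a : ℕ → F} (ha : ∃ t < n, a t ≠ 0) {B : Finset ℕ}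
    (hB : B ⊆ range n) : MuiM F (Fintype.card F) N n B ∈ formIdeal F N n a := by
  obtain ⟨u, -, h⟩ := exists_MuiM_eq_smul_mui (F := F) hn hB
  exact h ▸ Submodule.smul_mem _ _ (mui_mem_formIdeal hn ha B)

variable {m : ℕ} (hm : m ≤ N) (hmn : m ≤ n)
include hmn

theorem psi_MuiM_of_ne {B B' : Finset ℕ} (hB : B ⊆ range n) (hB' : B' ⊆ range n)
    (h : ¬B' ⊆ range m) (hne : B ≠ B') : psi hm B (MuiM F (Fintype.card F) N n B') = 0 := by
  obtain ⟨u, -, hu⟩ := exists_MuiM_eq_smul_mui (F := F) hn hB'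
  rw [hu, map_smul, psi_mui_of_ne hm hn hmn hB hB' h hne, smul_zero]

theorem psi_MuiM_self {B : Finset ℕ} (hB : B ⊆ range n) (h : ¬B ⊆ range m) :
    ∃ u : SV F N, u * u = 1 ∧
      psi hm B (MuiM F (Fintype.card F) N n B) = u * mooreDet F (xV F N) n := by
  obtain ⟨u, hu, hM⟩ := exists_MuiM_eq_smul_mui (F := F) hn hB
  obtain ⟨u', hu', hM'⟩ := psi_mui_self (F := F) hm hn hmn hB h
  refine ⟨u * u', by rw [mul_mul_mul_comm, hu, hu', one_mul], ?_⟩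
  rw [hM, map_smul, hM', smul_eq_mul, mul_assoc]

/-- The subsets of `{0, …, n - 1}` not contained in `{0, …, m - 1}`. -/
def newSubsets (m n : ℕ) : Finset (Finset ℕ) := {B ∈ (range n).powerset | ¬B ⊆ range m}

omit hn hmn in
theorem mem_newSubsets {B : Finset ℕ} : B ∈ newSubsets m n ↔ B ⊆ range n ∧ ¬B ⊆ range m := by
  rw [newSubsets, Finset.mem_filter, Finset.mem_powerset]

theorem psi_sum_MuiM {c : Finset ℕ → SV F N} {B : Finset ℕ} (hB : B ∈ newSubsets m n) :
    psi hm B (∑ B' ∈ newSubsets m n, c B' • MuiM F (Fintype.card F) N n B') =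
      c B * psi hm B (MuiM F (Fintype.card F) N n B) := by
  have hB1 := mem_newSubsets.1 hB
  rw [map_sum, Finset.sum_eq_single_of_mem B hB, map_smul, smul_eq_mul]
  intro B' hB' hne
  have hB2 := mem_newSubsets.1 hB'
  rw [map_smul, psi_MuiM_of_ne hn hm hmn hB1.1 hB2.1 hB2.2 hne.symm, smul_zero]

theorem exists_sub_sum_MuiM_mem_extSub (f : SL F N) (hf : f ∈ extSub F N n)
    (hP : ∀ a : ℕ → F, (∃ t < n, a t ≠ 0) → f ∈ extSub F N m ⊔ formIdeal F N n a) :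
    ∃ c : Finset ℕ → SV F N,
      f - ∑ B ∈ newSubsets m n, c B • MuiM F (Fintype.card F) N n B ∈ extSub F N m := by
  have hm : m ≤ N := hmn.trans hn
  have hdvd (B : Finset ℕ) : mooreDet F (xV F N) n ∣ psi hm B f := by
    refine mooreDet_dvd hn _ fun a ha => ?_
    obtain ⟨g, hg, j, hj, rfl⟩ := Submodule.mem_sup.1 (hP a ha)
    rw [map_add, psi_eq_zero hm hg, zero_add]
    exact psi_dvd_of_mem_formIdeal hm hn B hj
  choose k hk using hdvd
  have hu (B : Finset ℕ) : ∃ u : SV F N, B ∈ newSubsets m n → u * u = 1 ∧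
      psi hm B (MuiM F (Fintype.card F) N n B) = u * mooreDet F (xV F N) n := by
    by_cases hB : B ∈ newSubsets m n
    · obtain ⟨u, h⟩ := psi_MuiM_self (F := F) hn hm hmn (mem_newSubsets.1 hB).1
        (mem_newSubsets.1 hB).2
      exact ⟨u, fun _ => h⟩
    · exact ⟨0, fun h => absurd h hB⟩
  choose u hu using hu
  refine ⟨fun B => u B * k B, mem_extSub_of_psi_eq_zero hm hn hmn (Submodule.sub_mem _ hf
    (Submodule.sum_mem _ fun B hB => Submodule.smul_mem _ _
      (MuiM_mem_extSub hn (mem_newSubsets.1 hB).1))) fun B hB hBm => ?_⟩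
  have hB' : B ∈ newSubsets m n := mem_newSubsets.2 ⟨hB, hBm⟩
  rw [map_sub, psi_sum_MuiM hn hm hmn hB', hk, (hu B hB').2]
  linear_combination (-(k B * mooreDet F (xV F N) n)) * (hu B hB').1

end

variable {m : ℕ → ℕ} (hm : Monotone m) (hN : ∀ k, m k ≤ N) (h0 : m 0 = 0)
include hm hN

theorem MuiM_mem_sup {k i : ℕ} {a : ℕ → F} (ha : ∃ t < m (k + 1), a t ≠ 0) {B : Finset ℕ}
    (hB : B ⊆ range (m (i + 1))) : MuiM F (Fintype.card F) N (m (i + 1)) B ∈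
      extSub F N (m k) ⊔ formIdeal F N (m (k + 1)) a := by
  obtain h | h := Nat.lt_or_ge i k
  · exact Submodule.mem_sup_left (extSub_mono (hm h) (MuiM_mem_extSub (hN _) hB))
  · refine Submodule.mem_sup_right ?_
    have hle := hm (Nat.succ_le_succ h)
    rw [formIdeal_eq_of_le hle]
    obtain ⟨t, ht, hat⟩ := ha
    exact MuiM_mem_formIdeal (hN _) ⟨t, ht.trans_le hle, by rwa [if_pos ht]⟩ hB

include h0

theorem exists_eq_sum_MuiM (L : ℕ) (f : SL F N) (hf : f ∈ extSub F N (m L))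
    (hP : ∀ k, ∀ a : ℕ → F, (∃ t < m (k + 1), a t ≠ 0) →
      f ∈ extSub F N (m k) ⊔ formIdeal F N (m (k + 1)) a) :
    ∃ c₀ : SV F N, ∃ c : ℕ → Finset ℕ → SV F N, f = c₀ • 1 + ∑ i ∈ range L,
      ∑ B ∈ newSubsets (m i) (m (i + 1)), c i B • MuiM F (Fintype.card F) N (m (i + 1)) B := by
  induction L generalizing f with
  | zero =>
    rw [h0] at hf
    obtain ⟨s, rfl⟩ := Submodule.mem_span_singleton.1 hf
    exact ⟨s, 0, by simp⟩
  | succ L ih =>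
    obtain ⟨d, hd⟩ := exists_sub_sum_MuiM_mem_extSub (hN _) (hm L.le_succ) f hf (hP L)
    obtain ⟨c₀, c, hc⟩ := ih _ hd fun k a ha => Submodule.sub_mem _ (hP k a ha)
      (Submodule.sum_mem _ fun B hB => Submodule.smul_mem _ _
        (MuiM_mem_sup hm hN ha (mem_newSubsets.1 hB).1))
    refine ⟨c₀, Function.update c L d, ?_⟩
    rw [Finset.sum_range_succ, Function.update_self, ← add_assoc, ← sub_eq_iff_eq_add, hc]
    congr 1
    refine Finset.sum_congr rfl fun i hi => ?_
    rw [Function.update_of_ne (Finset.mem_range.1 hi).ne]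

omit h0 in
theorem eq_zero_of_sum_MuiM (L : ℕ) {c₀ : SV F N} {c : ℕ → Finset ℕ → SV F N}
    (h : c₀ • (1 : SL F N) + ∑ i ∈ range L, ∑ B ∈ newSubsets (m i) (m (i + 1)),
      c i B • MuiM F (Fintype.card F) N (m (i + 1)) B = 0) :
    c₀ = 0 ∧ ∀ i < L, ∀ B ∈ newSubsets (m i) (m (i + 1)), c i B = 0 := by
  induction L with
  | zero =>
    have := congrArg (aug F N) h
    simp only [Finset.range_zero, Finset.sum_empty, add_zero, map_smul, map_one, map_zero,
      smul_eq_mul, mul_one] at this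
    exact ⟨this, by simp⟩
  | succ L ih =>
    have hlow : c₀ • (1 : SL F N) + ∑ i ∈ range L, ∑ B ∈ newSubsets (m i) (m (i + 1)),
        c i B • MuiM F (Fintype.card F) N (m (i + 1)) B ∈ extSub F N (m L) :=
      Submodule.add_mem _ (Submodule.smul_mem _ _ (one_mem_extSub _)) <|
        Submodule.sum_mem _ fun i hi => Submodule.sum_mem _ fun B hB =>
          Submodule.smul_mem _ _ (extSub_mono (hm (Finset.mem_range.1 hi))
            (MuiM_mem_extSub (hN _) (mem_newSubsets.1 hB).1))
    rw [Finset.sum_range_succ, ← add_assoc] at h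
    have hL : ∀ B ∈ newSubsets (m L) (m (L + 1)), c L B = 0 := by
      intro B hB
      have h1 := congrArg (psi (hN L) B) h
      obtain ⟨u, hu, h2⟩ := psi_MuiM_self (F := F) (hN _) (hN L) (hm L.le_succ)
        (mem_newSubsets.1 hB).1 (mem_newSubsets.1 hB).2
      rw [map_add, psi_eq_zero _ hlow, zero_add, psi_sum_MuiM (hN _) _ (hm L.le_succ) hB, h2,
        map_zero] at h1
      refine (mul_eq_zero.1 h1).resolve_right (mul_ne_zero ?_ (mooreDet_ne_zero (hN _)))
      rintro rfl
      simp at hu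
    have hz : ∑ B ∈ newSubsets (m L) (m (L + 1)),
        c L B • MuiM F (Fintype.card F) N (m (L + 1)) B = 0 :=
      Finset.sum_eq_zero fun B hB => by rw [hL B hB, zero_smul]
    rw [hz, add_zero] at h
    obtain ⟨h1, h2⟩ := ih h
    refine ⟨h1, fun i hi => ?_⟩
    obtain h | rfl := Nat.lt_succ_iff_lt_or_eq.1 hi
    exacts [h2 i h, hL]

end Blocks

section Transvections

variable {F : Type} [Field F] {N : ℕ}

theorem smul_eq_tmul_mul (c : SV F N) (f : SL F N) : c • f = (c ⊗ₜ[F] 1) * f :=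
  Algebra.smul_def c f

theorem tAct_smul (g : Matrix (Fin N) (Fin N) F) (c : SV F N) (f : SL F N) :
    tAct F N g (c • f) = gAct F N g c • tAct F N g f := by
  rw [smul_eq_tmul_mul, map_mul, smul_eq_tmul_mul, tAct, Algebra.TensorProduct.map_tmul, map_one]

theorem gAct_xV (g : Matrix (Fin N) (Fin N) F) (j : Fin N) :
    gAct F N g (xV F N j) = ∑ i, g i j • xV F N i := by
  simp [gAct, xV, MvPolynomial.smul_eq_C_mul]

theorem tAct_yT (g : Matrix (Fin N) (Fin N) F) (j : Fin N) :
    tAct F N g (yT F N j) = ∑ i, (C (g i j) : SV F N) • yT F N i := by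
  have h (i : Fin N) : yV F N i = ExteriorAlgebra.ι F (Pi.single i (1 : F)) := yV_of_lt i.2
  simp only [yT, tAct, Algebra.TensorProduct.map_tmul, map_one, h, eAct,
    ExteriorAlgebra.map_apply_ι, Matrix.mulVecLin_apply, Matrix.mulVec_single_one]
  rw [pi_eq_sum_univ' (g.col j), map_sum, TensorProduct.tmul_sum]
  refine Finset.sum_congr rfl fun i _ => ?_
  rw [map_smul, ← TensorProduct.smul_tmul, TensorProduct.smul_tmul', smul_eq_mul,
    MvPolynomial.smul_eq_C_mul]
  rfl

/-- The transvection `1 + a φᵀ`. -/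
def transvec (N : ℕ) (a φ : ℕ → F) : Matrix (Fin N) (Fin N) F :=
  1 + Matrix.vecMulVec (fun i : Fin N => a i) fun j : Fin N => φ j

variable {a φ : ℕ → F}

theorem sum_transvec_smul {M : Type*} [AddCommMonoid M] [Module F M] (x : ℕ → M) (j : Fin N) :
    ∑ i, transvec N a φ i j • x i = x j + φ j • ∑ t ∈ range N, a t • x t := by
  simp only [transvec, Matrix.add_apply, Matrix.one_apply, Matrix.vecMulVec_apply, add_smul,
    Finset.sum_add_distrib, ite_smul, one_smul, zero_smul, Finset.sum_ite_eq', Finset.mem_univ,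
    if_true, Finset.smul_sum, Finset.sum_range, smul_smul, mul_comm]

theorem exists_gAct_transvec (p : SV F N) :
    ∃ h, gAct F N (transvec N a φ) p = p + linForm F N N a * h := by
  induction p using MvPolynomial.induction_on with
  | C c => exact ⟨0, by simp [gAct]⟩
  | add p p' hp hp' =>
    obtain ⟨h, hh⟩ := hp
    obtain ⟨h', hh'⟩ := hp'
    exact ⟨h + h', by rw [map_add, hh, hh']; ring⟩
  | mul_X p j hp =>
    obtain ⟨h, hh⟩ := hp
    have hX : (X j : SV F N) = xV F N j := by simp [xV]
    have hg := gAct_xV (transvec N a φ) j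
    rw [sum_transvec_smul, MvPolynomial.smul_eq_C_mul] at hg
    refine ⟨h * (X j + C (φ j) * linForm F N N a) + p * C (φ j), ?_⟩
    rw [map_mul, hh, hX, hg, linForm]
    ring

theorem yForm_mul_yT_mul (n s : ℕ) (f : SL F N) :
    yT F N s * (yForm F N n a * f) = -(yForm F N n a * (yT F N s * f)) := by
  simp only [yForm, Finset.sum_mul, Finset.mul_sum, smul_mul_assoc, mul_smul_comm]
  rw [← Finset.sum_neg_distrib]
  refine Finset.sum_congr rfl fun t _ => ?_
  rw [yT_left_comm]
  exact smul_neg _ _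

theorem yForm_mul_yForm_mul (n : ℕ) (f : SL F N) :
    yForm F N n a * (yForm F N n a * f) = 0 := by
  have h (n : ℕ) : yForm F N n a * yForm F N n a = 0 := by
    induction n with
    | zero => simp [yForm]
    | succ n ih =>
      have h1 := yForm_mul_yT_mul (a := a) n n (1 : SL F N)
      rw [mul_one, mul_one] at h1
      have h2 : yForm F N (n + 1) a = yForm F N n a + (C (a n) : SV F N) • yT F N n :=
        Finset.sum_range_succ _ _
      rw [h2, add_mul, mul_add, mul_add, ih, smul_mul_assoc, smul_mul_assoc, mul_smul_comm,
        mul_smul_comm, yT_mul_self, h1]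
      simp
  rw [← mul_assoc, h, zero_mul]

theorem exists_tAct_transvec (f : SL F N) :
    ∃ h, tAct F N (transvec N a φ) f =
      f + yForm F N N a * contr (fun t => C (φ t)) f + linForm F N N a • h := by
  let p : Submodule (SV F N) (SL F N) :=
    { carrier := {f | ∃ h, tAct F N (transvec N a φ) f =
        f + yForm F N N a * contr (fun t => C (φ t)) f + linForm F N N a • h}
      zero_mem' := ⟨0, by simp⟩
      add_mem' := by
        rintro f f' ⟨h, hh⟩ ⟨h', hh'⟩
        exact ⟨h + h', by rw [map_add, hh, hh', map_add, mul_add, smul_add]; abel⟩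
      smul_mem' := by
        rintro c f ⟨h, hh⟩
        obtain ⟨k, hk⟩ := exists_gAct_transvec (a := a) (φ := φ) c
        refine ⟨k • tAct F N (transvec N a φ) f + c • h, ?_⟩
        rw [tAct_smul, hk, add_smul, smul_add, smul_smul, map_smul, mul_smul_comm]
        nth_rewrite 1 [hh]
        rw [smul_add, smul_add, smul_comm c (linForm F N N a) h]
        abel }
  refine mem_of_yT_mul_mem p ⟨0, by simp [contr_one]⟩ ?_ f
  rintro s hs f ⟨h, hh⟩
  have hy : tAct F N (transvec N a φ) (yT F N s) =
      yT F N s + (C (φ s) : SV F N) • yForm F N N a := by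
    have hF (c : F) (z : SL F N) : (C c : SV F N) • z = c • z :=
      algebraMap_smul (SV F N) c z
    rw [yForm]
    simp only [hF]
    rw [← sum_transvec_smul (yT F N) ⟨s, hs⟩]
    simpa only [hF] using tAct_yT (transvec N a φ) ⟨s, hs⟩
  refine ⟨yT F N s * h + (C (φ s) : SV F N) • (yForm F N N a * h), ?_⟩
  rw [map_mul, hy, hh, contr_yT_mul _ hs, mul_sub, mul_smul_comm]
  simp only [add_mul, mul_add, smul_mul_assoc, mul_smul_comm, yForm_mul_yForm_mul,
    yForm_mul_yT_mul, smul_add, smul_zero]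
  abel

theorem mem_sup_formIdeal_of_dvd {m s : ℕ} (hm : m ≤ N) (hs : s < N) (has : a s ≠ 0)
    (hms : m ≤ s ∨ ∀ t, m ≤ t → a t = 0) {f : SL F N}
    (h : ∀ φ : ℕ → F, (∀ t < m, φ t = 0) → ∑ t ∈ range N, a t * φ t = 0 →
      ∃ g, yForm F N N a * contr (fun t => C (φ t)) f = linForm F N N a • g) :
    f ∈ extSub F N m ⊔ formIdeal F N N a := by
  set w : ℕ → SV F N := Pi.single s (C (a s)⁻¹)
  set y := yForm F N N a
  set r := contr w (y * f) with hr
  have hf : f = r + y * contr w f := by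
    rw [hr, contr_yForm_mul le_rfl, sum_C_mul_single hs has, one_smul, sub_add_cancel]
  have hsr : contr (Pi.single s 1) r = 0 := by
    have : (Pi.single s 1 : ℕ → SV F N) = fun t => C (a s) * w t := by
      funext t
      obtain rfl | ht := eq_or_ne t s
      · simp only [w, Pi.single_eq_same]
        rw [← C_mul, mul_inv_cancel₀ has, C_1]
      · simp only [w, Pi.single_eq_of_ne ht, mul_zero]
    rw [this, contr_smul, LinearMap.smul_apply, hr, contr_contr, smul_zero]
  have hb (b : ℕ) (hmb : m ≤ b) (hbN : b < N) :
      ∃ g, contr (Pi.single b 1) r = linForm F N N a • g := by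
    set φ : ℕ → F := Pi.single b 1 - (a b / a s) • Pi.single s 1 with hφ
    have hφ0 : ∑ t ∈ range N, a t * φ t = 0 := by
      simp only [hφ, Pi.sub_apply, Pi.smul_apply, smul_eq_mul, mul_sub, Finset.sum_sub_distrib,
        Pi.single_apply, mul_ite, mul_one, mul_zero, Finset.sum_ite_eq', Finset.mem_range, hbN, hs,
        if_true]
      field_simp
      ring
    obtain ⟨g, hg⟩ := h φ (fun t ht => by
      have h1 : t ≠ b := by omega
      obtain h2 | h2 := hms
      · have h3 : t ≠ s := by omega
        simp [hφ, h1, h3]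
      · simp [hφ, h1, h2 b hmb]) hφ0
    have h0 : ∑ t ∈ range N, (C (a t) : SV F N) * C (φ t) = 0 := by
      simp only [← C_mul]
      rw [← map_sum, hφ0, C_0]
    have hv : (Pi.single b 1 : ℕ → SV F N) =
        (fun t => C (φ t)) + fun t => C (a b / a s) * (Pi.single s 1 : ℕ → SV F N) t := by
      funext t
      simp only [hφ, Pi.add_apply, Pi.sub_apply, Pi.smul_apply, Pi.single_apply, smul_eq_mul]
      split_ifs <;> simp
    refine ⟨contr w g, ?_⟩
    rw [hv, contr_add, contr_smul, LinearMap.add_apply, LinearMap.smul_apply, hsr, smul_zero,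
      add_zero, hr, contr_comm, contr_yForm_mul le_rfl, h0, zero_smul, zero_sub, hg]
    rw [← map_smul, ← map_neg]
    congr 1
    exact neg_neg _
  obtain ⟨r', hr', g, hg⟩ := mem_extSub_of_contr_mem hm le_rfl _ (mem_extSub_self r) hb
  rw [hf, hg, add_assoc]
  exact Submodule.add_mem_sup hr' (mem_formIdeal.2 ⟨contr w f, g, add_comm _ _⟩)

end Transvections

section Parabolic

variable {F : Type} [Field F] {N : ℕ} (I : Composition N)

theorem blkIdx_eq_index (a : Fin N) : blkIdx N I a = I.index a := by
  have : {i ∈ range I.length | I.sizeUpTo (i + 1) ≤ a} = range (I.index a) := by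
    ext i
    simp only [Finset.mem_filter, Finset.mem_range]
    constructor
    · rintro ⟨-, h⟩
      by_contra! hi
      exact (I.lt_sizeUpTo_index_succ a).not_ge
        ((I.monotone_sizeUpTo (Nat.succ_le_succ hi)).trans h)
    · intro h
      exact ⟨h.trans (I.index a).2, (I.monotone_sizeUpTo h).trans (I.sizeUpTo_index_le a)⟩
  rw [blkIdx, this, Finset.card_range]

theorem index_lt_of_lt_sizeUpTo {k : ℕ} {a : Fin N} (h : (a : ℕ) < I.sizeUpTo k) :
    (I.index a : ℕ) < k := by
  by_contra! hk
  exact h.not_ge ((I.monotone_sizeUpTo hk).trans (I.sizeUpTo_index_le a))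

theorem le_index_of_sizeUpTo_le {k : ℕ} {a : Fin N} (h : I.sizeUpTo k ≤ a) :
    k ≤ (I.index a : ℕ) := by
  by_contra! hk
  exact (I.lt_sizeUpTo_index_succ a).not_ge ((I.monotone_sizeUpTo (Nat.succ_le_of_lt hk)).trans h)

theorem det_one_add_vecMulVec {ι : Type*} [Fintype ι] [DecidableEq ι] (u v : ι → F) :
    (1 + Matrix.vecMulVec u v).det = 1 + v ⬝ᵥ u := by
  rw [Matrix.vecMulVec_eq Unit, Matrix.det_one_add_replicateCol_mul_replicateRow]

theorem transvec_mem_KIset {k : ℕ} {a φ : ℕ → F}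
    (ha : ∀ t, I.sizeUpTo (k + 1) ≤ t → a t = 0) (hφ : ∀ t < I.sizeUpTo k, φ t = 0)
    (h : ∑ t ∈ range N, a t * φ t = 0) : transvec N a φ ∈ KIset F N I := by
  have ha' {i : Fin N} (h : a i ≠ 0) : (I.index i : ℕ) < k + 1 :=
    index_lt_of_lt_sizeUpTo I (by_contra fun hi => h (ha _ (not_lt.1 hi)))
  have hφ' {i : Fin N} (h : φ i ≠ 0) : k ≤ (I.index i : ℕ) :=
    le_index_of_sizeUpTo_le I (by_contra fun hi => h (hφ _ (not_le.1 hi)))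
  have h0 : ∑ i : Fin N, φ i * a i = 0 := by
    rw [← h, Finset.sum_range]
    exact Finset.sum_congr rfl fun i _ => mul_comm _ _
  refine ⟨?_, ?_, fun i => ?_⟩
  · rw [transvec, det_one_add_vecMulVec, dotProduct, h0, add_zero]
    exact isUnit_one
  · intro i j hij
    rw [blkIdx_eq_index, blkIdx_eq_index] at hij
    have hne : i ≠ j := by
      rintro rfl
      exact lt_irrefl _ hij
    rw [transvec, Matrix.add_apply, Matrix.one_apply_ne hne, zero_add, Matrix.vecMulVec_apply]
    by_contra hc
    have h1 := ha' (left_ne_zero_of_mul hc)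
    have h2 := hφ' (right_ne_zero_of_mul hc)
    omega
  · have hsub : (Matrix.of fun s t : Fin (I.blocksFun i) =>
        transvec N a φ (I.embedding i s) (I.embedding i t)) =
        1 + Matrix.vecMulVec (fun s => a (I.embedding i s)) fun t => φ (I.embedding i t) := by
      ext s t
      simp [transvec, Matrix.one_apply, Matrix.vecMulVec_apply]
    rw [hsub, det_one_add_vecMulVec, add_eq_left, dotProduct]
    obtain rfl | hik := eq_or_ne (i : ℕ) k
    · refine (Fintype.sum_of_injective _ (I.embedding i).injective _ (fun t => φ t * a t)
        (fun t ht => ?_) fun _ => rfl).trans h0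
      by_contra hc
      have h1 := ha' (right_ne_zero_of_mul hc)
      have h2 := hφ' (left_ne_zero_of_mul hc)
      have h3 : I.index t = i := Fin.ext (by omega)
      exact ht (h3 ▸ ⟨_, I.embedding_comp_inv t⟩)
    · refine Finset.sum_eq_zero fun t _ => ?_
      by_contra hc
      have h1 := ha' (right_ne_zero_of_mul hc)
      have h2 := hφ' (left_ne_zero_of_mul hc)
      rw [I.index_embedding] at h1 h2
      omega

theorem mem_extSub_sup_formIdeal_of_mem_invSL {f : SL F N} (hf : f ∈ invSL F N (KIset F N I))
    (k : ℕ) {a : ℕ → F} (ha : ∃ t < I.sizeUpTo (k + 1), a t ≠ 0) :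
    f ∈ extSub F N (I.sizeUpTo k) ⊔ formIdeal F N (I.sizeUpTo (k + 1)) a := by
  rw [formIdeal_eq_of_le (I.sizeUpTo_le (k + 1))]
  set a' : ℕ → F := fun t => if t < I.sizeUpTo (k + 1) then a t else 0 with ha'
  have key (φ : ℕ → F) (hφ : ∀ t < I.sizeUpTo k, φ t = 0)
      (h0 : ∑ t ∈ range N, a' t * φ t = 0) :
      ∃ g, yForm F N N a' * contr (fun t => C (φ t)) f = linForm F N N a' • g := by
    have hg := hf _ (transvec_mem_KIset I (k := k) (fun t ht => if_neg ht.not_gt) hφ h0)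
    obtain ⟨h, hh⟩ := exists_tAct_transvec (a := a') (φ := φ) f
    rw [hg, add_assoc, left_eq_add, add_comm] at hh
    refine ⟨-h, ?_⟩
    rw [eq_neg_of_add_eq_zero_right hh]
    exact (smul_neg _ _).symm
  by_cases hs : ∃ s, I.sizeUpTo k ≤ s ∧ a' s ≠ 0
  · obtain ⟨s, hks, has⟩ := hs
    have hsN : s < I.sizeUpTo (k + 1) := by_contra fun h => has (if_neg h)
    exact mem_sup_formIdeal_of_dvd (I.sizeUpTo_le k) (hsN.trans_le (I.sizeUpTo_le _)) has
      (Or.inl hks) key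
  · push Not at hs
    obtain ⟨s, hsk, has⟩ := ha
    exact mem_sup_formIdeal_of_dvd (I.sizeUpTo_le k) (hsk.trans_le (I.sizeUpTo_le _))
      (by simpa only [ha', if_pos hsk] using has) (Or.inr hs) key

end Parabolic

section Invariance

theorem alternatingMap_apply_eq_det_smul {R M : Type*} [CommRing R] [AddCommGroup M] [Module R M]
    {n : ℕ} (f : (Fin n → R) [⋀^Fin n]→ₗ[R] M) (A : Matrix (Fin n) (Fin n) R) :
    (f fun i j => A i j) = A.det • f fun i => Pi.single i 1 := by
  have h : f = (LinearMap.toSpanSingleton R M (f fun i => Pi.single i 1)).compAlternatingMap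
      Matrix.detRowAlternating := by
    refine (Pi.basisFun R (Fin n)).ext_alternating fun w hw => ?_
    obtain ⟨σ, rfl⟩ : ∃ σ : Equiv.Perm (Fin n), w = σ :=
      ⟨Equiv.ofBijective w (Finite.injective_iff_bijective.1 hw), rfl⟩
    have h1 := f.map_perm (fun i => Pi.single i 1) σ
    have h2 := (Matrix.detRowAlternating (R := R)).map_perm (fun i : Fin n => Pi.single i 1) σ
    have h3 : (Matrix.detRowAlternating fun i : Fin n => (Pi.single i 1 : Fin n → R)) = 1 := by
      refine (congrArg Matrix.det ?_).trans Matrix.det_one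
      ext i j
      rw [Matrix.one_apply, Pi.single_apply]
      simp only [eq_comm]
    simp only [Pi.basisFun_apply, LinearMap.compAlternatingMap_apply,
      LinearMap.toSpanSingleton_apply]
    refine h1.trans ?_
    rw [← Function.comp_def (fun i : Fin n => (Pi.single i 1 : Fin n → R)) σ, h2, h3]
    rcases Int.units_eq_one_or (Equiv.Perm.sign σ) with h | h <;> simp [h]
  exact congrArg (fun f => f fun i j => A i j) h

variable {F : Type} [Field F] {N : ℕ}

theorem yProd_range {n : ℕ} (hn : n ≤ N) : yProd F N (range n) =
    ExteriorAlgebra.ιMulti F n fun i => Pi.single (Fin.castLE hn i) 1 := by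
  rw [yProd, Finset.sort_range, ExteriorAlgebra.ιMulti_apply]
  congr 1
  refine List.ext_getElem (by simp) fun i h1 h2 => ?_
  simp only [List.getElem_map, List.getElem_range, List.getElem_ofFn]
  exact yV_of_lt _

theorem eAct_yProd_range {n : ℕ} (hn : n ≤ N) (g : Matrix (Fin N) (Fin N) F)
    (hg : ∀ i j : Fin N, (j : ℕ) < n → n ≤ (i : ℕ) → g i j = 0) :
    eAct F N g (yProd F N (range n)) =
      (g.submatrix (Fin.castLE hn) (Fin.castLE hn)).det • yProd F N (range n) := by
  let W : (Fin n → F) →ₗ[F] Fin N → F :=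
    LinearMap.pi fun i => if h : (i : ℕ) < n then LinearMap.proj ⟨i, h⟩ else 0
  have hW (v : Fin n → F) (i : Fin N) : W v i = if h : (i : ℕ) < n then v ⟨i, h⟩ else 0 := by
    simp only [W, LinearMap.pi_apply]
    split_ifs <;> rfl
  have hg' : (fun j i => (g.submatrix (Fin.castLE hn) (Fin.castLE hn)).transpose j i) =
      fun j : Fin n => fun i : Fin n => g (Fin.castLE hn i) (Fin.castLE hn j) := rfl
  have hdet := alternatingMap_apply_eq_det_smul ((ExteriorAlgebra.ιMulti F n).compLinearMap W)
    (g.submatrix (Fin.castLE hn) (Fin.castLE hn)).transpose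
  have h1 : g.mulVecLin ∘ (fun j : Fin n => Pi.single (Fin.castLE hn j) 1) =
      fun j => W fun i => g (Fin.castLE hn i) (Fin.castLE hn j) := by
    funext j i
    rw [Function.comp_apply, Matrix.mulVecLin_apply, Matrix.mulVec_single_one, Matrix.col_apply, hW]
    split_ifs with h
    · rfl
    · exact hg _ _ j.2 (not_lt.1 h)
  have h2 : (fun j : Fin n => (Pi.single (Fin.castLE hn j) 1 : Fin N → F)) =
      fun j => W (Pi.single j 1) := by
    funext j i
    rw [hW, Pi.single_apply]
    split_ifs with h1 h2 h2
    · subst h1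
      exact (Pi.single_eq_same (M := fun _ : Fin n => F) j 1).symm
    · exact absurd (h1 ▸ j.2) h2
    · rw [Pi.single_apply, if_neg]
      rintro rfl
      exact h1 rfl
    · rfl
  rw [yProd_range hn, eAct, ExteriorAlgebra.map_apply_ιMulti, h1, h2, ← Matrix.det_transpose]
  rw [hg'] at hdet
  exact hdet

variable [Fintype F]

theorem gAct_frob (g : Matrix (Fin N) (Fin N) F) (j : Fin N) (c : ℕ) :
    gAct F N g (xV F N j ^ Fintype.card F ^ c) =
      ∑ i, C (g i j) * xV F N i ^ Fintype.card F ^ c := by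
  rw [map_pow, gAct_xV, sum_smul_pow_card]
  simp only [MvPolynomial.smul_eq_C_mul]

theorem tAct_dFrob (g : Matrix (Fin N) (Fin N) F) (c : ℕ) (f : SL F N) :
    tAct F N g (dFrob F N c f) = dFrob F N c (tAct F N g f) := by
  let p : Submodule (SV F N) (SL F N) :=
    { carrier := {f | tAct F N g (dFrob F N c f) = dFrob F N c (tAct F N g f)}
      zero_mem' := by simp
      add_mem' := by
        intro f f' hf hf'
        change _ = _ at hf hf' ⊢
        simp only [map_add, hf, hf']
      smul_mem' := by
        intro s f hf
        change _ = _ at hf ⊢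
        rw [map_smul, tAct_smul, hf, tAct_smul, map_smul] }
  refine mem_of_yT_mul_mem p ?_ ?_ f
  · change tAct F N g (dFrob F N c 1) = dFrob F N c (tAct F N g 1)
    rw [map_one (tAct F N g), dFrob, contr_one, map_zero]
  · intro j hj f hf
    change tAct F N g (dFrob F N c (yT F N j * f)) = dFrob F N c (tAct F N g (yT F N j * f))
    change tAct F N g (dFrob F N c f) = dFrob F N c (tAct F N g f) at hf
    rw [dFrob] at hf ⊢
    have hy := tAct_yT g ⟨j, hj⟩
    have hx := gAct_frob g ⟨j, hj⟩ c
    simp only at hy hx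
    rw [contr_yT_mul _ hj, map_sub, tAct_smul, hx, map_mul, map_mul, hf, hy]
    simp only [Finset.sum_mul, map_sum, smul_mul_assoc, map_smul, contr_yT_mul _ (Fin.is_lt _),
      smul_sub, Finset.sum_sub_distrib, Finset.sum_smul, smul_smul]

theorem tAct_dProd (g : Matrix (Fin N) (Fin N) F) (B : Finset ℕ) (f : SL F N) :
    tAct F N g (dProd F N B f) = dProd F N B (tAct F N g f) := by
  induction B using Finset.induction_on_min generalizing f with
  | empty => simp [dProd, sortedProd_empty]
  | insert a B ha ih =>
    simp only [dProd, sortedProd_insert _ ha, Module.End.mul_apply, tAct_dFrob] at ih ⊢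
    rw [ih]

theorem tAct_mui {n : ℕ} (hn : n ≤ N) {g : Matrix (Fin N) (Fin N) F}
    (hg : ∀ i j : Fin N, (j : ℕ) < n → n ≤ (i : ℕ) → g i j = 0)
    (hdet : (g.submatrix (Fin.castLE hn) (Fin.castLE hn)).det = 1) (B : Finset ℕ) :
    tAct F N g (mui F N n B) = mui F N n B := by
  rw [mui, tAct_dProd, ← one_tmul_yProd, tAct, Algebra.TensorProduct.map_tmul, map_one,
    eAct_yProd_range hn g hg, hdet, one_smul]

variable (I : Composition N)

omit [Fintype F] in
theorem det_submatrix_castLE_of_mem_KIset {g : Matrix (Fin N) (Fin N) F} (hg : g ∈ KIset F N I)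
    (k : ℕ) : (g.submatrix (Fin.castLE (I.sizeUpTo_le k)) (Fin.castLE (I.sizeUpTo_le k))).det =
      1 := by
  set A := g.submatrix (Fin.castLE (I.sizeUpTo_le k)) (Fin.castLE (I.sizeUpTo_le k)) with hA
  let b (a : Fin (I.sizeUpTo k)) : Fin I.length := I.index (Fin.castLE (I.sizeUpTo_le k) a)
  have htri : A.BlockTriangular b := fun i j hij => hg.2.1 _ _ <| by
    rwa [blkIdx_eq_index, blkIdx_eq_index]
  rw [htri.det]
  refine Finset.prod_eq_one fun i hi => ?_
  obtain ⟨a, -, rfl⟩ := Finset.mem_image.1 hi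
  have hlt (t : Fin (I.blocksFun (b a))) : (I.embedding (b a) t : ℕ) < I.sizeUpTo k :=
    ((I.mem_range_embedding_iff.1 ⟨t, rfl⟩).2).trans_le
      (I.monotone_sizeUpTo (index_lt_of_lt_sizeUpTo I a.2))
  let e : Fin (I.blocksFun (b a)) ≃ {c // b c = b a} := Equiv.ofBijective
    (fun t => ⟨⟨I.embedding (b a) t, hlt t⟩, I.index_embedding (b a) t⟩)
    ⟨fun t t' h => (I.embedding (b a)).injective
      (Fin.ext (congrArg (fun c : {c // b c = b a} => (c : ℕ)) h)), fun ⟨c, hc⟩ => by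
        obtain ⟨t, ht⟩ : Fin.castLE (I.sizeUpTo_le k) c ∈ Set.range (I.embedding (b a)) :=
          hc ▸ ⟨_, I.embedding_comp_inv _⟩
        exact ⟨t, Subtype.ext (Fin.ext (congrArg (fun i : Fin N => (i : ℕ)) ht))⟩⟩
  rw [← Matrix.det_submatrix_equiv_self e]
  exact hg.2.2 (b a)

theorem tAct_MuiM {g : Matrix (Fin N) (Fin N) F} (hg : g ∈ KIset F N I) (k : ℕ) {B : Finset ℕ}
    (hB : B ⊆ range (I.sizeUpTo k)) :
    tAct F N g (MuiM F (Fintype.card F) N (I.sizeUpTo k) B) =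
      MuiM F (Fintype.card F) N (I.sizeUpTo k) B := by
  have hmui := tAct_mui (I.sizeUpTo_le k) (fun i j hj hi => hg.2.1 _ _ ?_)
    (det_submatrix_castLE_of_mem_KIset I hg k) B
  · obtain ⟨u, hu, h⟩ := exists_MuiM_eq_smul_mui (F := F) (I.sizeUpTo_le k) hB
    have hu' : gAct F N g u = u := by
      obtain rfl | rfl := mul_self_eq_one_iff.1 hu <;> simp
    rw [h, tAct_smul, hu', hmui]
  · rw [blkIdx_eq_index, blkIdx_eq_index]
    exact (index_lt_of_lt_sizeUpTo I hj).trans_le (le_index_of_sizeUpTo_le I hi)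

end Invariance

section FreeBasis

variable {F : Type} [Field F] [Fintype F] {N : ℕ} (I : Composition N)

theorem mem_Adm {x : Fin I.length × Finset ℕ} :
    x ∈ Adm N I ↔ x.2 ∈ newSubsets (I.sizeUpTo x.1) (I.sizeUpTo (x.1 + 1)) := by
  rw [Adm, Finset.mem_filter, mem_newSubsets, Finset.mem_product, Finset.mem_powerset,
    Finset.not_subset]
  simp only [Finset.mem_univ, true_and, Finset.mem_range, not_lt]
  constructor
  · rintro ⟨-, h1, -, h2⟩
    exact ⟨h1, h2⟩
  · rintro ⟨h1, b, hb, hbm⟩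
    exact ⟨h1.trans (Finset.range_subset_range.2 (I.sizeUpTo_le _)), h1, ⟨b, hb⟩, b, hb, hbm⟩

theorem sum_Adm {M : Type*} [AddCommMonoid M] (g : ℕ → Finset ℕ → M) :
    ∑ x ∈ Adm N I, g x.1 x.2 = ∑ i ∈ range I.length,
      ∑ B ∈ newSubsets (I.sizeUpTo i) (I.sizeUpTo (i + 1)), g i B := by
  rw [Finset.sum_range, Finset.sum_sigma']
  exact Finset.sum_bij' (fun x _ => ⟨x.1, x.2⟩) (fun x _ => (x.1, x.2))
    (fun x hx => by simpa using (mem_Adm I).1 hx) (fun x hx => (mem_Adm I).2 (by simpa using hx))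
    (fun _ _ => rfl) (fun _ _ => rfl) fun _ _ => rfl

theorem eq_zero_of_sum_Adm {c₀ : SV F N} {c : Fin I.length × Finset ℕ → SV F N}
    (h : c₀ ⊗ₜ[F] 1 + ∑ x ∈ Adm N I, (c x ⊗ₜ[F] 1) *
      MuiM F (Fintype.card F) N (I.sizeUpTo ((x.1 : ℕ) + 1)) x.2 = 0) :
    c₀ = 0 ∧ ∀ x ∈ Adm N I, c x = 0 := by
  let c' (i : ℕ) (B : Finset ℕ) : SV F N := if h : i < I.length then c (⟨i, h⟩, B) else 0
  have hc' (x : Fin I.length × Finset ℕ) : c' x.1 x.2 = c x := dif_pos x.1.2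
  simp only [← hc', ← smul_eq_tmul_mul] at h
  rw [sum_Adm I fun i B => c' i B • MuiM F (Fintype.card F) N (I.sizeUpTo (i + 1)) B,
    ← mul_one (c₀ ⊗ₜ[F] 1), ← smul_eq_tmul_mul] at h
  obtain ⟨h1, h2⟩ := eq_zero_of_sum_MuiM I.monotone_sizeUpTo I.sizeUpTo_le I.length h
  exact ⟨h1, fun x hx => hc' x ▸ h2 x.1 x.1.2 x.2 ((mem_Adm I).1 hx)⟩

theorem exists_eq_sum_Adm {f : SL F N} (hf : f ∈ invSL F N (KIset F N I)) :
    ∃ c₀ : SV F N, ∃ c : Fin I.length × Finset ℕ → SV F N,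
      f = c₀ ⊗ₜ[F] 1 + ∑ x ∈ Adm N I, (c x ⊗ₜ[F] 1) *
        MuiM F (Fintype.card F) N (I.sizeUpTo ((x.1 : ℕ) + 1)) x.2 := by
  obtain ⟨c₀, c, hc⟩ := exists_eq_sum_MuiM I.monotone_sizeUpTo I.sizeUpTo_le I.sizeUpTo_zero
    I.length f (by rw [I.sizeUpTo_length]; exact mem_extSub_self f)
    fun k a ha => mem_extSub_sup_formIdeal_of_mem_invSL I hf k ha
  refine ⟨c₀, fun x => c x.1 x.2, ?_⟩
  simp only [← smul_eq_tmul_mul]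
  rw [sum_Adm I fun i B => c i B • MuiM F (Fintype.card F) N (I.sizeUpTo (i + 1)) B, hc,
    ← mul_one (c₀ ⊗ₜ[F] 1), ← smul_eq_tmul_mul]

theorem tAct_sum_Adm {g : Matrix (Fin N) (Fin N) F} (hg : g ∈ KIset F N I) (c₀ : SV F N)
    (c : Fin I.length × Finset ℕ → SV F N) :
    tAct F N g (c₀ ⊗ₜ[F] 1 + ∑ x ∈ Adm N I, (c x ⊗ₜ[F] 1) *
        MuiM F (Fintype.card F) N (I.sizeUpTo ((x.1 : ℕ) + 1)) x.2) =
      gAct F N g c₀ ⊗ₜ[F] 1 + ∑ x ∈ Adm N I, (gAct F N g (c x) ⊗ₜ[F] 1) *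
        MuiM F (Fintype.card F) N (I.sizeUpTo ((x.1 : ℕ) + 1)) x.2 := by
  have h (p : SV F N) : tAct F N g (p ⊗ₜ[F] 1) = gAct F N g p ⊗ₜ[F] 1 := by
    rw [tAct, Algebra.TensorProduct.map_tmul, map_one]
  rw [map_add, map_sum, h]
  congr 1
  refine Finset.sum_congr rfl fun x hx => ?_
  rw [map_mul, h, tAct_MuiM I hg _ (mem_newSubsets.1 ((mem_Adm I).1 hx)).1]

theorem mem_invS_of_sum_Adm_mem_invSL {c₀ : SV F N} {c : Fin I.length × Finset ℕ → SV F N}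
    (hf : c₀ ⊗ₜ[F] 1 + ∑ x ∈ Adm N I, (c x ⊗ₜ[F] 1) *
      MuiM F (Fintype.card F) N (I.sizeUpTo ((x.1 : ℕ) + 1)) x.2 ∈ invSL F N (KIset F N I)) :
    c₀ ∈ invS F N (KIset F N I) ∧ ∀ x ∈ Adm N I, c x ∈ invS F N (KIset F N I) := by
  have key {g : Matrix (Fin N) (Fin N) F} (hg : g ∈ KIset F N I) :
      gAct F N g c₀ - c₀ = 0 ∧ ∀ x ∈ Adm N I, gAct F N g (c x) - c x = 0 := by
    refine eq_zero_of_sum_Adm I ?_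
    have h := hf g hg
    rw [tAct_sum_Adm I hg, ← sub_eq_zero, add_sub_add_comm, ← Finset.sum_sub_distrib] at h
    simpa only [TensorProduct.sub_tmul, sub_mul] using h
  exact ⟨fun g hg => sub_eq_zero.1 (key hg).1, fun x hx g hg => sub_eq_zero.1 ((key hg).2 x hx)⟩

end FreeBasis

/-- **Theorem 2.8(2)** (Wan–Wang, after Minh–Tùng). `(S(V) ⊗ Λ(V))^{K_I}` is a
free `S(V)^{K_I}`-module with basis `1` together with the elements
`M_{m_i;b_1,…,b_j}` for `1 ≤ j ≤ n`, `1 ≤ i ≤ ℓ` with `m_i ≥ j`, and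
`0 ≤ b_1 < ⋯ < b_j ≤ m_i − 1` with `b_j ≥ m_{i−1}`. -/
theorem KI_invariants_free_basis
    (F : Type) [Field F] [Fintype F] (p r q n : ℕ)
    (hp : p.Prime) (hr : 0 < r) (hq : q = p ^ r) (hF : Fintype.card F = q)
    (I : Composition n) :
    (∀ f : SL F n, f ∈ invSL F n (KIset F n I) ↔
        ∃ c₀ : SV F n, ∃ c : Fin I.length × Finset ℕ → SV F n,
          c₀ ∈ invS F n (KIset F n I) ∧
          (∀ x ∈ Adm n I, c x ∈ invS F n (KIset F n I)) ∧
          f = c₀ ⊗ₜ[F] 1 + ∑ x ∈ Adm n I, (c x ⊗ₜ[F] 1) *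
            MuiM F q n (I.sizeUpTo ((x.1 : ℕ) + 1)) x.2)
    ∧ (∀ c₀ : SV F n, ∀ c : Fin I.length × Finset ℕ → SV F n,
        c₀ ∈ invS F n (KIset F n I) →
        (∀ x ∈ Adm n I, c x ∈ invS F n (KIset F n I)) →
        c₀ ⊗ₜ[F] 1 + ∑ x ∈ Adm n I, (c x ⊗ₜ[F] 1) *
          MuiM F q n (I.sizeUpTo ((x.1 : ℕ) + 1)) x.2 = 0 →
        c₀ = 0 ∧ ∀ x ∈ Adm n I, c x = 0) := by
  subst hF
  refine ⟨fun f => ⟨fun hf => ?_, ?_⟩, fun _ _ _ _ h => eq_zero_of_sum_Adm I h⟩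
  · obtain ⟨c₀, c, rfl⟩ := exists_eq_sum_Adm I hf
    obtain ⟨h₀, h⟩ := mem_invS_of_sum_Adm_mem_invSL I hf
    exact ⟨c₀, c, h₀, h, rfl⟩
  · rintro ⟨c₀, c, h₀, h, rfl⟩ g hg
    rw [tAct_sum_Adm I hg, h₀ g hg]
    congr 1
    exact Finset.sum_congr rfl fun x hx => by rw [h x hx g hg]

end
end
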